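/- A binary relation ≻ on F satisfies Axioms 1–7 if and only if there exist a non-constant affine function u : X → ℝ and non-empty compact convex subsets C, D of Δ with C ∩ D ≠ ∅ such that for all f, g ∈ F: f ≻ g iff both min_{p∈C} ∫u(f)dp > min_{p∈C} ∫u(g)dp and max_{p∈D} ∫u(f)dp > max_{p∈D} ∫u(g)dp. Moreover, in this case u is unique up to positive affine transformation and the pair (C, D) is unique. -/

import Mathlib

/-!
Framework: Anscombe–Aumann acts, finitely additive probability measures,
simple acts, hope-and-prepare preferences (Bastianello–Hill style setup).
-/

open Set

section Framework

variable (S : Type*) [MeasurableSpace S]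

/-- The measurable sets (events) of `S`, as a subtype. -/
abbrev MSet := {A : Set S // MeasurableSet A}

/-- Finitely additive probability measures on `(S, Σ)`, viewed as real-valued
set functions on events.  The weak* topology is the topology of pointwise
convergence on events, i.e. the product topology on `MSet S → ℝ`. -/
def ProbCharges : Set (MSet S → ℝ) :=
  {p | (∀ A, 0 ≤ p A) ∧ p ⟨Set.univ, MeasurableSet.univ⟩ = 1 ∧
    ∀ A B : MSet S, Disjoint A.1 B.1 → p ⟨A.1 ∪ B.1, A.2.union B.2⟩ = p A + p B}

end Framework

section Fns

variable {S : Type*} [MeasurableSpace S]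

/-- `φ : S → ℝ` is a measurable simple function (an element of `B₀(Σ)`). -/
def IsSimpleFn (φ : S → ℝ) : Prop :=
  (Set.range φ).Finite ∧ ∀ y : ℝ, MeasurableSet (φ ⁻¹' {y})

/-- The integral `∫ φ dp` of a simple function `φ` against a finitely additive
measure `p` (junk value `0` if `φ` is not simple). -/
noncomputable def fInt (p : MSet S → ℝ) (φ : S → ℝ) : ℝ :=
  @dite _ (IsSimpleFn φ) (Classical.dec _)
    (fun h => ∑ y ∈ h.1.toFinset, y * p ⟨φ ⁻¹' {y}, h.2 y⟩) (fun _ => 0)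

/-- A functional `I : B₀(Σ) → ℝ` is monotonic. -/
def MonotonicFn (I : (S → ℝ) → ℝ) : Prop :=
  ∀ φ ψ, IsSimpleFn φ → IsSimpleFn ψ → (∀ s, φ s ≤ ψ s) → I φ ≤ I ψ

/-- A functional `I : B₀(Σ) → ℝ` is constant-linear: `I(aφ + b) = a I(φ) + b`
for `a ≥ 0`, `b ∈ ℝ`. -/
def ConstLinearFn (I : (S → ℝ) → ℝ) : Prop :=
  ∀ φ, IsSimpleFn φ → ∀ a : ℝ, 0 ≤ a → ∀ b : ℝ,
    I (fun s => a * φ s + b) = a * I φ + b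

end Fns

section Acts

variable {S : Type*} [MeasurableSpace S] {V : Type*} [AddCommGroup V] [Module ℝ V]

/-- `f : S → V` is a simple act with outcomes in `X`: it is `X`-valued,
takes finitely many values and is `Σ`-measurable. -/
def IsAct (X : Set V) (f : S → V) : Prop :=
  (∀ s, f s ∈ X) ∧ (Set.range f).Finite ∧ ∀ v : V, MeasurableSet (f ⁻¹' {v})

/-- Pointwise mixture `αf + (1-α)g` of two acts. -/
def mixAct (α : ℝ) (f g : S → V) : S → V := fun s => α • f s + (1 - α) • g s

/-- The constant act with outcome `x`. -/
def constAct (S : Type*) {V : Type*} (x : V) : S → V := fun _ => x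

/-- `u : V → ℝ` is affine on the convex set `X`. -/
def IsAffineOn (u : V → ℝ) (X : Set V) : Prop :=
  ∀ x ∈ X, ∀ y ∈ X, ∀ α : ℝ, 0 ≤ α → α ≤ 1 →
    u (α • x + (1 - α) • y) = α * u x + (1 - α) * u y

/-- `u` is non-constant on `X`. -/
def NonConstOn (u : V → ℝ) (X : Set V) : Prop := ∃ x ∈ X, ∃ y ∈ X, u x ≠ u y

/-- Expected utility `∫ u(f) dp` of the act `f` under the measure `p`. -/
noncomputable def EU (u : V → ℝ) (f : S → V) (p : MSet S → ℝ) : ℝ :=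
  fInt p (fun s => u (f s))

/-- Worst-case expected utility of `f` over the set of scenarios `C`. -/
noncomputable def minEU (u : V → ℝ) (C : Set (MSet S → ℝ)) (f : S → V) : ℝ :=
  sInf (EU u f '' C)

/-- Best-case expected utility of `f` over the set of scenarios `D`. -/
noncomputable def maxEU (u : V → ℝ) (D : Set (MSet S → ℝ)) (f : S → V) : ℝ :=
  sSup (EU u f '' D)

/-- `f` and `g` are incomparable (`f ⋈ g`). -/
def Incomp (R : (S → V) → (S → V) → Prop) (f g : S → V) : Prop := ¬ R f g ∧ ¬ R g f

end Acts

section Axioms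

variable {S : Type*} [MeasurableSpace S] {V : Type*} [AddCommGroup V] [Module ℝ V]
variable (X : Set V) (R : (S → V) → (S → V) → Prop)

/-- Axiom 1: `≻` is asymmetric and transitive on acts, and its restriction to
constant acts is non-trivial and negatively transitive. -/
def PrefAx1 : Prop :=
  (∀ f g, IsAct X f → IsAct X g → R f g → ¬ R g f) ∧
  (∀ f g h, IsAct X f → IsAct X g → IsAct X h → R f g → R g h → R f h) ∧
  (∃ x ∈ X, ∃ y ∈ X, R (constAct S x) (constAct S y)) ∧
  (∀ x ∈ X, ∀ y ∈ X, ∀ z ∈ X, ¬ R (constAct S x) (constAct S y) →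
    ¬ R (constAct S y) (constAct S z) → ¬ R (constAct S x) (constAct S z))

/-- Axiom 2 (continuity). -/
def PrefAx2 : Prop :=
  ∀ f g h, IsAct X f → IsAct X g → IsAct X h →
    IsOpen {α : Set.Icc (0 : ℝ) 1 | R (mixAct (α : ℝ) f g) h} ∧
    IsOpen {α : Set.Icc (0 : ℝ) 1 | R h (mixAct (α : ℝ) f g)}

/-- Axiom 3 (certainty independence). -/
def PrefAx3 : Prop :=
  ∀ f g, IsAct X f → IsAct X g → ∀ x ∈ X, ∀ α : ℝ, 0 < α → α < 1 →
    (R f g ↔ R (mixAct α f (constAct S x)) (mixAct α g (constAct S x)))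

/-- Axiom 4: for any outcome `x`, the upper and lower contour sets at the
constant act `x` are convex. -/
def PrefAx4 : Prop :=
  ∀ x ∈ X,
    (∀ f g, IsAct X f → IsAct X g → R f (constAct S x) → R g (constAct S x) →
      ∀ α : ℝ, 0 ≤ α → α ≤ 1 → R (mixAct α f g) (constAct S x)) ∧
    (∀ f g, IsAct X f → IsAct X g → R (constAct S x) f → R (constAct S x) g →
      ∀ α : ℝ, 0 ≤ α → α ≤ 1 → R (constAct S x) (mixAct α f g))

/-- Axiom 5 (monotonicity). -/
def PrefAx5 : Prop :=
  ∀ f g, IsAct X f → IsAct X g →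
    (∀ s : S, R (constAct S (f s)) (constAct S (g s))) → R f g

/-- Axiom 6: if every outcome incomparable to `f` is incomparable to `g`,
then `f` and `g` are incomparable. -/
def PrefAx6 : Prop :=
  ∀ f g, IsAct X f → IsAct X g →
    (∀ x ∈ X, Incomp R f (constAct S x) → Incomp R g (constAct S x)) → Incomp R f g

/-- Axiom 7: if `f ⋈ x`, `x ≻ g`, `g ⋈ y` and `f ≻ y`, then `f ≻ g`. -/
def PrefAx7 : Prop :=
  ∀ f g, IsAct X f → IsAct X g → ∀ x ∈ X, ∀ y ∈ X,
    Incomp R f (constAct S x) → R (constAct S x) g →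
    Incomp R g (constAct S y) → R f (constAct S y) → R f g

end Axioms

section Reps

variable {S : Type*} [MeasurableSpace S] {V : Type*} [AddCommGroup V] [Module ℝ V]

/-- `(u, C, D)` is a hope-and-prepare representation of `R`. -/
def IsHPRep (X : Set V) (R : (S → V) → (S → V) → Prop) (u : V → ℝ)
    (C D : Set (MSet S → ℝ)) : Prop :=
  IsAffineOn u X ∧ NonConstOn u X ∧
  C.Nonempty ∧ D.Nonempty ∧ C ⊆ ProbCharges S ∧ D ⊆ ProbCharges S ∧
  IsCompact C ∧ IsCompact D ∧ Convex ℝ C ∧ Convex ℝ D ∧ (C ∩ D).Nonempty ∧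
  ∀ f g, IsAct X f → IsAct X g →
    (R f g ↔ (minEU u C g < minEU u C f ∧ maxEU u D g < maxEU u D f))

/-- `(u, C)` is a Bewley representation of `R`. -/
def IsBewleyRep (X : Set V) (R : (S → V) → (S → V) → Prop) (u : V → ℝ)
    (C : Set (MSet S → ℝ)) : Prop :=
  IsAffineOn u X ∧ NonConstOn u X ∧
  C.Nonempty ∧ C ⊆ ProbCharges S ∧ IsCompact C ∧ Convex ℝ C ∧
  ∀ f g, IsAct X f → IsAct X g → (R f g ↔ ∀ p ∈ C, EU u g p < EU u f p)

/-- `(u, C, D)` is a twofold multi-prior representation of `R`. -/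
def IsTwofoldRep (X : Set V) (R : (S → V) → (S → V) → Prop) (u : V → ℝ)
    (C D : Set (MSet S → ℝ)) : Prop :=
  IsAffineOn u X ∧ NonConstOn u X ∧
  C.Nonempty ∧ D.Nonempty ∧ C ⊆ ProbCharges S ∧ D ⊆ ProbCharges S ∧
  IsCompact C ∧ IsCompact D ∧ Convex ℝ C ∧ Convex ℝ D ∧ (C ∩ D).Nonempty ∧
  ∀ f g, IsAct X f → IsAct X g → (R f g ↔ maxEU u D g < minEU u C f)

end Reps

open MeasureTheory

section Charges

variable {S : Type*} [MeasurableSpace S]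

theorem isSimpleFn_coe (φ : SimpleFunc S ℝ) : IsSimpleFn φ :=
  ⟨φ.finite_range, φ.measurableSet_fiber⟩

theorem fInt_coe (p : MSet S → ℝ) (φ : SimpleFunc S ℝ) :
    fInt p φ = ∑ y ∈ φ.range, y * p ⟨φ ⁻¹' {y}, φ.measurableSet_fiber y⟩ := by
  rw [fInt, dif_pos (isSimpleFn_coe φ)]
  rfl

open Classical in
/-- The extension of a set function on events to all sets, with values in the operators on `ℝ`. -/
noncomputable def chargeOp (p : MSet S → ℝ) (A : Set S) : ℝ →L[ℝ] ℝ :=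
  if h : MeasurableSet A then p ⟨A, h⟩ • ContinuousLinearMap.id ℝ ℝ else 0

theorem fInt_eq_setToSimpleFunc (p : MSet S → ℝ) (φ : SimpleFunc S ℝ) :
    fInt p φ = φ.setToSimpleFunc (chargeOp p) := by
  rw [fInt_coe, SimpleFunc.setToSimpleFunc]
  refine Finset.sum_congr rfl fun y _ => ?_
  simp [chargeOp, φ.measurableSet_fiber y, mul_comm]

theorem finMeasAdditive_chargeOp {p : MSet S → ℝ} (hp : p ∈ ProbCharges S) :
    FinMeasAdditive (0 : Measure S) (chargeOp p) := by
  intro A B hA hB _ _ hAB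
  simp only [chargeOp, hA, hB, hA.union hB, dif_pos]
  rw [hp.2.2 ⟨A, hA⟩ ⟨B, hB⟩ hAB, add_smul]

theorem ProbCharges.empty {p : MSet S → ℝ} (hp : p ∈ ProbCharges S) :
    p ⟨∅, MeasurableSet.empty⟩ = 0 := by
  have h := hp.2.2 ⟨∅, MeasurableSet.empty⟩ ⟨∅, MeasurableSet.empty⟩ (by simp)
  simpa using h

/-- Integration against a finitely additive probability, as a linear functional. -/
noncomputable def chargeInt {p : MSet S → ℝ} (hp : p ∈ ProbCharges S) :
    SimpleFunc S ℝ →ₗ[ℝ] ℝ where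
  toFun φ := fInt p φ
  map_add' φ ψ := by
    simp only [fInt_eq_setToSimpleFunc]
    exact SimpleFunc.setToSimpleFunc_add _ (finMeasAdditive_chargeOp hp) (by simp) (by simp)
  map_smul' c φ := by
    simp only [fInt_eq_setToSimpleFunc]
    exact SimpleFunc.setToSimpleFunc_smul_real _ (finMeasAdditive_chargeOp hp) c (by simp)

theorem chargeInt_apply {p : MSet S → ℝ} (hp : p ∈ ProbCharges S) (φ : SimpleFunc S ℝ) :
    chargeInt hp φ = fInt p φ := rfl

theorem chargeInt_const {p : MSet S → ℝ} (hp : p ∈ ProbCharges S) (c : ℝ) :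
    chargeInt hp (SimpleFunc.const S c) = c := by
  rw [chargeInt_apply, fInt_eq_setToSimpleFunc, SimpleFunc.setToSimpleFunc_const]
  · simp [chargeOp, hp.2.1]
  · rw [chargeOp, dif_pos MeasurableSet.empty, ProbCharges.empty hp, zero_smul]

theorem chargeInt_nonneg {p : MSet S → ℝ} (hp : p ∈ ProbCharges S) {φ : SimpleFunc S ℝ}
    (h : ∀ s, 0 ≤ φ s) : 0 ≤ chargeInt hp φ := by
  rw [chargeInt_apply, fInt_coe]
  refine Finset.sum_nonneg fun y hy => mul_nonneg ?_ (hp.1 _)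
  obtain ⟨s, rfl⟩ := SimpleFunc.mem_range.1 hy
  exact h s

theorem chargeInt_mono {p : MSet S → ℝ} (hp : p ∈ ProbCharges S) {φ ψ : SimpleFunc S ℝ}
    (h : ∀ s, φ s ≤ ψ s) : chargeInt hp φ ≤ chargeInt hp ψ := by
  have := chargeInt_nonneg hp (φ := ψ - φ) fun s => by simpa using h s
  rw [map_sub] at this
  linarith

/-- The indicator function of an event, scaled by `c`. -/
noncomputable def scaledIndicator (A : MSet S) (c : ℝ) : SimpleFunc S ℝ :=
  SimpleFunc.piecewise A.1 A.2 (SimpleFunc.const S c) (SimpleFunc.const S 0)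

open Classical in
theorem scaledIndicator_apply (A : MSet S) (c : ℝ) (s : S) :
    scaledIndicator A c s = if s ∈ A.1 then c else 0 := by
  simp [scaledIndicator, SimpleFunc.piecewise_apply]

theorem scaledIndicator_eq_smul (A : MSet S) (c : ℝ) :
    scaledIndicator A c = c • scaledIndicator A 1 := by
  ext s
  simp [scaledIndicator_apply]

theorem chargeInt_scaledIndicator {p : MSet S → ℝ} (hp : p ∈ ProbCharges S) (A : MSet S)
    (c : ℝ) : chargeInt hp (scaledIndicator A c) = c * p A := by
  classical
  rw [scaledIndicator_eq_smul, map_smul, smul_eq_mul]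
  congr 1
  rw [chargeInt_apply, fInt_coe]
  have hpre : (scaledIndicator A 1 : S → ℝ) ⁻¹' {1} = A.1 := by
    ext s
    simp [scaledIndicator_apply]
  have key : ∀ y ∈ (scaledIndicator A 1).range, y ≠ 1 →
      y * p ⟨scaledIndicator A 1 ⁻¹' {y}, (scaledIndicator A 1).measurableSet_fiber y⟩ = 0 := by
    intro y hy hy1
    obtain ⟨s, rfl⟩ := SimpleFunc.mem_range.1 hy
    rw [scaledIndicator_apply] at hy1 ⊢
    split_ifs at hy1 ⊢ with h
    · exact absurd rfl hy1
    · simp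
  rw [Finset.sum_eq_single 1 key]
  · simp only [one_mul]
    congr 1
    exact Subtype.ext hpre
  · intro h1
    have he : A.1 = ∅ := by
      by_contra hne
      obtain ⟨s, hs⟩ := Set.nonempty_iff_ne_empty.2 hne
      exact h1 (SimpleFunc.mem_range.2 ⟨s, by simp [scaledIndicator_apply, hs]⟩)
    have hA : (⟨scaledIndicator A 1 ⁻¹' {1}, (scaledIndicator A 1).measurableSet_fiber 1⟩ : MSet S)
        = ⟨∅, MeasurableSet.empty⟩ := Subtype.ext (hpre.trans he)
    rw [hA, ProbCharges.empty hp, mul_zero]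

/-- Two linear functionals on simple functions agreeing on indicators are equal. -/
theorem linearMap_eq_of_indicator {g h : SimpleFunc S ℝ →ₗ[ℝ] ℝ}
    (H : ∀ A, g (scaledIndicator A 1) = h (scaledIndicator A 1)) : g = h := by
  ext φ
  induction φ using SimpleFunc.induction with
  | const c hs =>
    have := H ⟨_, hs⟩
    change g (scaledIndicator ⟨_, hs⟩ c) = h (scaledIndicator ⟨_, hs⟩ c)
    rw [scaledIndicator_eq_smul, map_smul, map_smul, this]
  | add _ h₁ h₂ => rw [map_add, map_add, h₁, h₂]

theorem continuous_fInt (φ : SimpleFunc S ℝ) : Continuous fun p : MSet S → ℝ => fInt p φ := by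
  simp only [fInt_coe]
  fun_prop

theorem isClosed_probCharges : IsClosed (ProbCharges S) := by
  have h : ProbCharges S = (⋂ A : MSet S, {p | 0 ≤ p A}) ∩
      ({p | p ⟨Set.univ, MeasurableSet.univ⟩ = 1} ∩
      ⋂ A : MSet S, ⋂ B : MSet S, ⋂ _ : Disjoint A.1 B.1,
        {p | p ⟨A.1 ∪ B.1, A.2.union B.2⟩ = p A + p B}) := by
    ext p
    simp [ProbCharges]
  rw [h]
  refine (isClosed_iInter fun A => isClosed_le continuous_const (continuous_apply A)).inter
    ((isClosed_eq (continuous_apply _) continuous_const).inter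
    (isClosed_iInter fun A => isClosed_iInter fun B => isClosed_iInter fun _ =>
      isClosed_eq (continuous_apply _) ((continuous_apply A).add (continuous_apply B))))

theorem ProbCharges.le_one {p : MSet S → ℝ} (hp : p ∈ ProbCharges S) (A : MSet S) : p A ≤ 1 := by
  have h := hp.2.2 A ⟨A.1ᶜ, A.2.compl⟩ disjoint_compl_right
  have h1 := hp.2.1
  have h2 := hp.1 ⟨A.1ᶜ, A.2.compl⟩
  simp only [Set.union_compl_self] at h
  linarith

theorem isCompact_probCharges : IsCompact (ProbCharges S) := by
  refine (isCompact_univ_pi fun _ : MSet S => isCompact_Icc (a := (0 : ℝ)) (b := 1)).of_isClosed_subset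
    isClosed_probCharges fun p hp A _ => ⟨hp.1 A, ProbCharges.le_one hp A⟩

theorem convex_probCharges : Convex ℝ (ProbCharges S) := by
  intro p hp q hq a b ha hb hab
  refine ⟨fun A => ?_, ?_, fun A B hAB => ?_⟩
  · have := hp.1 A
    have := hq.1 A
    simp only [Pi.add_apply, Pi.smul_apply, smul_eq_mul]
    positivity
  · simp [hp.2.1, hq.2.1, hab]
  · simp only [Pi.add_apply, Pi.smul_apply, smul_eq_mul, hp.2.2 A B hAB, hq.2.2 A B hAB]
    ring

theorem fInt_combo (φ : SimpleFunc S ℝ) (p q : MSet S → ℝ) (a b : ℝ) :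
    fInt (a • p + b • q) φ = a * fInt p φ + b * fInt q φ := by
  simp only [fInt_coe, Pi.add_apply, Pi.smul_apply, smul_eq_mul, Finset.mul_sum,
    ← Finset.sum_add_distrib]
  exact Finset.sum_congr rfl fun y _ => by ring

/-- Continuous linear functionals on set functions act on probabilities as integration of a
simple function. -/
theorem exists_simpleFunc_of_dual (l : StrongDual ℝ (MSet S → ℝ)) :
    ∃ φ : SimpleFunc S ℝ, ∀ p ∈ ProbCharges S, l p = fInt p φ := by
  classical
  obtain ⟨F, hF⟩ : ∃ F : Finset (MSet S), ∀ p : MSet S → ℝ, (∀ A ∈ F, p A = 0) → l p = 0 := by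
    have hopen : IsOpen (l ⁻¹' Metric.ball 0 1) := Metric.isOpen_ball.preimage l.continuous
    obtain ⟨F, u, hu, hsub⟩ := isOpen_pi_iff.1 hopen 0 (by simp)
    refine ⟨F, fun p hp => ?_⟩
    by_contra hne
    have hmem : (l p)⁻¹ • p ∈ l ⁻¹' Metric.ball 0 1 := by
      refine hsub fun A hA => ?_
      have := (hu A hA).2
      simpa [hp A hA] using this
    simp [hne] at hmem
  refine ⟨∑ A ∈ F, scaledIndicator A (l (Pi.single A 1)), fun p hp => ?_⟩
  rw [← chargeInt_apply hp, map_sum]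
  simp only [chargeInt_scaledIndicator]
  have h := hF (p - ∑ A ∈ F, p A • Pi.single A (1 : ℝ)) fun A hA => by
    simp [Finset.sum_apply, Pi.single_apply, hA]
  rw [map_sub, map_sum, sub_eq_zero] at h
  rw [h]
  exact Finset.sum_congr rfl fun A _ => by rw [map_smul, smul_eq_mul, mul_comm]

theorem exists_simpleFunc_separating {K L : Set (MSet S → ℝ)} (hK : K ⊆ ProbCharges S)
    (hL : L ⊆ ProbCharges S) (hKc : IsCompact K) (hLc : IsCompact L) (hKv : Convex ℝ K)
    (hLv : Convex ℝ L) (hKL : Disjoint K L) :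
    ∃ (φ : SimpleFunc S ℝ) (r : ℝ), (∀ p ∈ K, fInt p φ < r) ∧ ∀ q ∈ L, r < fInt q φ := by
  obtain ⟨l, s, t, h₁, hst, h₂⟩ :=
    geometric_hahn_banach_compact_closed hKv hKc hLv hLc.isClosed hKL
  obtain ⟨φ, hφ⟩ := exists_simpleFunc_of_dual l
  refine ⟨φ, s, fun p hp => ?_, fun q hq => ?_⟩
  · rw [← hφ p (hK hp)]
    exact h₁ p hp
  · rw [← hφ q (hL hq)]
    exact hst.trans (h₂ q hq)

/-- A monotone, constant-linear and superadditive functional on simple functions is the lower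
envelope of a compact convex set of finitely additive probabilities. -/
theorem exists_charges_isLeast {I : SimpleFunc S ℝ → ℝ}
    (mono : ∀ φ ψ : SimpleFunc S ℝ, (∀ s, φ s ≤ ψ s) → I φ ≤ I ψ)
    (hom : ∀ (c : ℝ) (φ : SimpleFunc S ℝ), 0 < c → I (c • φ) = c * I φ)
    (trans : ∀ (φ : SimpleFunc S ℝ) (b : ℝ), I (φ + SimpleFunc.const S b) = I φ + b)
    (superadd : ∀ φ ψ, I φ + I ψ ≤ I (φ + ψ)) :
    ∃ C : Set (MSet S → ℝ), C.Nonempty ∧ C ⊆ ProbCharges S ∧ IsCompact C ∧ Convex ℝ C ∧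
      ∀ φ : SimpleFunc S ℝ, IsLeast ((fun p => fInt p φ) '' C) (I φ) := by
  have I0 : I 0 = 0 := by
    have := hom 2 0 two_pos
    rw [smul_zero] at this
    linarith
  have Ic : ∀ b, I (SimpleFunc.const S b) = b := fun b => by
    have := trans 0 b
    rwa [zero_add, I0, zero_add] at this
  let C : Set (MSet S → ℝ) := ProbCharges S ∩ ⋂ φ : SimpleFunc S ℝ, {p | I φ ≤ fInt p φ}
  have hC : ∀ φ : SimpleFunc S ℝ, IsLeast ((fun p => fInt p φ) '' C) (I φ) := by
    intro φ
    refine ⟨?_, ?_⟩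
    swap
    · rintro _ ⟨p, hp, rfl⟩
      exact Set.mem_iInter.1 hp.2 φ
    let f : SimpleFunc S ℝ →ₗ.[ℝ] ℝ := LinearPMap.mkSpanSingleton' φ (I φ) (by
      intro c hc
      rcases smul_eq_zero.1 hc with h | h
      · simp [h]
      · simp [h, I0])
    obtain ⟨g, hgf, hgN⟩ := exists_extension_of_le_sublinear f (fun ψ => -I (-ψ))
      (fun c hc ψ => by rw [← smul_neg, hom c _ hc]; ring)
      (fun ψ χ => by
        have := superadd (-ψ) (-χ)
        rw [neg_add]
        linarith)
      (by
        rintro ⟨ψ, hψ⟩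
        obtain ⟨c, rfl⟩ := Submodule.mem_span_singleton.1 hψ
        simp only [f]
        rw [LinearPMap.mkSpanSingleton'_apply, RingHom.id_apply, smul_eq_mul]
        rcases lt_trichotomy c 0 with h | h | h
        · have := hom (-c) φ (by linarith)
          rw [← neg_smul, this]
          linarith
        · simp [h, I0]
        · have h1 := hom c φ h
          have h2 := superadd (c • φ) (-(c • φ))
          rw [add_neg_cancel, I0] at h2
          linarith)
    have hgI : ∀ ψ, I ψ ≤ g ψ := fun ψ => by
      have := hgN (-ψ)
      rw [neg_neg, map_neg] at this
      linarith
    have hgφ : g φ = I φ := by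
      have hmem : φ ∈ f.domain := Submodule.mem_span_singleton_self φ
      rw [hgf ⟨φ, hmem⟩]
      have := LinearPMap.mkSpanSingleton'_apply_self φ (I φ) (by
        intro c hc
        rcases smul_eq_zero.1 hc with h | h
        · simp [h]
        · simp [h, I0]) hmem
      exact this
    let p : MSet S → ℝ := fun A => g (scaledIndicator A 1)
    have hp : p ∈ ProbCharges S := by
      refine ⟨fun A => ?_, ?_, fun A B hAB => ?_⟩
      · refine le_trans ?_ (hgI _)
        rw [← I0]
        refine mono _ _ fun s => ?_
        classical
        rw [scaledIndicator_apply, SimpleFunc.coe_zero, Pi.zero_apply]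
        split_ifs <;> norm_num
      · have h1 : scaledIndicator (⟨Set.univ, MeasurableSet.univ⟩ : MSet S) 1
            = SimpleFunc.const S 1 := by
          ext s
          simp [scaledIndicator_apply]
        have h2 : -SimpleFunc.const S (1 : ℝ) = SimpleFunc.const S (-1) := by
          ext s
          simp
        have h3 := hgI (SimpleFunc.const S 1)
        have h4 := hgI (-SimpleFunc.const S 1)
        rw [map_neg, h2, Ic] at h4
        rw [Ic] at h3
        simp only [p, h1]
        linarith
      · simp only [p]
        rw [← map_add]
        congr 1
        ext s
        classical
        have hd : s ∈ A.1 → s ∉ B.1 := fun h h' => Set.disjoint_left.1 hAB h h'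
        simp only [SimpleFunc.coe_add, Pi.add_apply, scaledIndicator_apply, Set.mem_union]
        by_cases h1 : s ∈ A.1 <;> by_cases h2 : s ∈ B.1 <;> simp_all
    have hpg : chargeInt hp = g := linearMap_eq_of_indicator fun A => by
      rw [chargeInt_scaledIndicator, one_mul]
    refine ⟨p, ⟨hp, Set.mem_iInter.2 fun ψ => ?_⟩, ?_⟩
    · change I ψ ≤ fInt p ψ
      rw [← chargeInt_apply hp, hpg]
      exact hgI ψ
    · change fInt p φ = I φ
      rw [← chargeInt_apply hp, hpg, hgφ]
  refine ⟨C, ?_, fun p hp => hp.1, ?_, ?_, hC⟩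
  · obtain ⟨p, hp, _⟩ := (hC 0).1
    exact ⟨p, hp⟩
  · exact isCompact_probCharges.inter_right (isClosed_iInter fun φ =>
      isClosed_le continuous_const (continuous_fInt φ))
  · refine convex_probCharges.inter (convex_iInter fun φ => ?_)
    intro p hp q hq a b ha hb hab
    change I φ ≤ fInt (a • p + b • q) φ
    rw [fInt_combo]
    have h1 : I φ ≤ fInt p φ := hp
    have h2 : I φ ≤ fInt q φ := hq
    calc I φ = a * I φ + b * I φ := by rw [← add_mul, hab, one_mul]
      _ ≤ _ := by gcongr

end Charges

section Utility

variable {V : Type*} [AddCommGroup V] [Module ℝ V]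

theorem convex_mix {X : Set V} (hX : Convex ℝ X) {x y : V} (hx : x ∈ X) (hy : y ∈ X) {α : ℝ}
    (h0 : 0 ≤ α) (h1 : α ≤ 1) : α • x + (1 - α) • y ∈ X :=
  hX hx hy h0 (by linarith) (by ring)

/-- Expected utility theorem on a convex set: a weak order satisfying independence and
continuity along segments is represented by an affine function. -/
theorem exists_affine_utility {X : Set V} (hX : Convex ℝ X) {P : V → V → Prop}
    (asym : ∀ x ∈ X, ∀ y ∈ X, P x y → ¬ P y x)
    (trans : ∀ x ∈ X, ∀ y ∈ X, ∀ z ∈ X, P x y → P y z → P x z)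
    (negtrans : ∀ x ∈ X, ∀ y ∈ X, ∀ z ∈ X, ¬ P x y → ¬ P y z → ¬ P x z)
    (nontriv : ∃ x ∈ X, ∃ y ∈ X, P x y)
    (indep : ∀ x ∈ X, ∀ y ∈ X, ∀ z ∈ X, ∀ α : ℝ, 0 < α → α < 1 →
      (P x y ↔ P (α • x + (1 - α) • z) (α • y + (1 - α) • z)))
    (cont_left : ∀ x ∈ X, ∀ y ∈ X, ∀ z ∈ X, P x z →
      ∃ δ : ℝ, 0 < δ ∧ δ < 1 ∧ ∀ ε : ℝ, 0 < ε → ε ≤ δ → P ((1 - ε) • x + ε • y) z)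
    (cont_right : ∀ x ∈ X, ∀ y ∈ X, ∀ z ∈ X, P z x →
      ∃ δ : ℝ, 0 < δ ∧ δ < 1 ∧ ∀ ε : ℝ, 0 < ε → ε ≤ δ → P z ((1 - ε) • x + ε • y)) :
    ∃ u : V → ℝ, IsAffineOn u X ∧ ∀ x ∈ X, ∀ y ∈ X, (P x y ↔ u y < u x) := by
  obtain ⟨x₀, hx₀, y₀, hy₀, h₀⟩ := nontriv
  have indep' : ∀ x ∈ X, ∀ y ∈ X, ∀ z ∈ X, ∀ α : ℝ, 0 < α → α < 1 →
      (P x y ↔ P ((1 - α) • z + α • x) ((1 - α) • z + α • y)) := by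
    intro x hx y hy z hz α h h'
    rw [indep x hx y hy z hz α h h', add_comm, add_comm (α • y)]
  let K : Set V := {v | ∃ c : ℝ, 0 < c ∧ ∃ p ∈ X, ∃ q ∈ X, P p q ∧ v = c • (p - q)}
  have K_smul : ∀ v ∈ K, ∀ c : ℝ, 0 < c → c • v ∈ K := by
    rintro _ ⟨d, hd, p, hp, q, hq, hpq, rfl⟩ c hc
    exact ⟨c * d, mul_pos hc hd, p, hp, q, hq, hpq, smul_smul _ _ _⟩
  have combine : ∀ (c d : ℝ), 0 < c → 0 < d → ∀ p ∈ X, ∀ q ∈ X, ∀ p' ∈ X, ∀ q' ∈ X,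
      P p q → ¬ P q' p' → c • (p - q) + d • (p' - q') ∈ K := by
    intro c d hc hd p hp q hq p' hp' q' hq' hpq hpq'
    have ht0 : 0 < c / (c + d) := by positivity
    have ht1 : c / (c + d) < 1 := by rw [div_lt_one (by positivity)]; linarith
    have h1 := (indep p hp q hq p' hp' _ ht0 ht1).1 hpq
    have h2 := mt (indep' q' hq' p' hp' q hq (1 - c / (c + d)) (by linarith) (by linarith)).2 hpq'
    simp only [sub_sub_cancel] at h2
    refine ⟨c + d, by positivity, _, convex_mix hX hp hp' ht0.le ht1.le, _,
      convex_mix hX hq hq' ht0.le ht1.le, ?_, ?_⟩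
    · by_contra hcon
      exact negtrans _ (convex_mix hX hp hp' ht0.le ht1.le) _
        (convex_mix hX hq hq' ht0.le ht1.le) _ (convex_mix hX hq hp' ht0.le ht1.le) hcon h2 h1
    · match_scalars <;> field_simp <;> ring
  have K_add : ∀ v ∈ K, ∀ w ∈ K, v + w ∈ K := by
    rintro _ ⟨c, hc, p, hp, q, hq, hpq, rfl⟩ _ ⟨d, hd, p', hp', q', hq', hpq', rfl⟩
    exact combine c d hc hd p hp q hq p' hp' q' hq' hpq (asym _ hp' _ hq' hpq')
  have K_zero : (0 : V) ∉ K := by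
    rintro ⟨c, hc, p, hp, q, hq, hpq, h⟩
    rcases smul_eq_zero.1 h.symm with h | h
    · linarith
    · obtain rfl := sub_eq_zero.1 h
      exact asym _ hp _ hp hpq hpq
  have K_neg : ∀ v ∈ K, -v ∉ K := fun v hv hv' => K_zero (by simpa using K_add v hv _ hv')
  have K_iff : ∀ x ∈ X, ∀ y ∈ X, (P x y ↔ x - y ∈ K) := by
    intro x hx y hy
    refine ⟨fun h => ⟨1, one_pos, x, hx, y, hy, h, by simp⟩, ?_⟩
    rintro ⟨c, hc, p, hp, q, hq, hpq, h⟩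
    by_contra hxy
    have := combine c 1 hc one_pos p hp q hq y hy x hx hpq hxy
    rw [← h, one_smul, sub_add_sub_cancel, sub_self] at this
    exact K_zero this
  have K_open : ∀ v ∈ K, ∀ x ∈ X, ∀ y ∈ X, ∃ ε : ℝ, 0 < ε ∧ v + ε • (x - y) ∈ K := by
    rintro _ ⟨c, hc, p, hp, q, hq, hpq, rfl⟩ x hx y hy
    have hm := convex_mix hX hp hq (α := 1 / 2) (by norm_num) (by norm_num)
    have hpm : P p ((1 / 2 : ℝ) • p + (1 - 1 / 2 : ℝ) • q) := by
      rw [K_iff _ hp _ hm]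
      convert K_smul _ ((K_iff _ hp _ hq).1 hpq) (1 / 2) (by norm_num) using 1
      module
    have hmq : P ((1 / 2 : ℝ) • p + (1 - 1 / 2 : ℝ) • q) q := by
      rw [K_iff _ hm _ hq]
      convert K_smul _ ((K_iff _ hp _ hq).1 hpq) (1 / 2) (by norm_num) using 1
      module
    obtain ⟨δ₁, h1, h1', H1⟩ := cont_left p hp x hx _ hm hpm
    obtain ⟨δ₂, h2, h2', H2⟩ := cont_right q hq y hy _ hm hmq
    have hδ : 0 < min δ₁ δ₂ := lt_min h1 h2
    have hδ1 : min δ₁ δ₂ < 1 := (min_le_left _ _).trans_lt h1'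
    have G1 := H1 _ hδ (min_le_left _ _)
    have G2 := H2 _ hδ (min_le_right _ _)
    set δ := min δ₁ δ₂
    have hpx : (1 - δ) • p + δ • x ∈ X := hX hp hx (by linarith) hδ.le (by ring)
    have hqy : (1 - δ) • q + δ • y ∈ X := hX hq hy (by linarith) hδ.le (by ring)
    have h1δ : 0 < 1 - δ := by linarith
    refine ⟨c * δ / (1 - δ), by positivity, c / (1 - δ), by positivity, _, hpx, _, hqy,
      trans _ hpx _ hm _ hqy G1 G2, ?_⟩
    match_scalars <;> field_simp
  set e : V := x₀ - y₀ with he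
  have heK : e ∈ K := (K_iff _ hx₀ _ hy₀).1 h₀
  -- differences `x - x₀ - t e` are multiples of differences of elements of `X`
  have diff_form : ∀ x ∈ X, ∀ t : ℝ, ∃ c : ℝ, 0 < c ∧ ∃ p ∈ X, ∃ q ∈ X,
      x - x₀ - t • e = c • (p - q) := by
    intro x hx t
    rcases le_or_gt 0 t with ht | ht
    · refine ⟨1 + t, by linarith, (1 / (1 + t)) • x + (1 - 1 / (1 + t)) • y₀,
        convex_mix hX hx hy₀ (by positivity) ?_, x₀, hx₀, ?_⟩
      · rw [div_le_one (by linarith)]; linarith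
      · have : 1 + t ≠ 0 := by linarith
        rw [he]
        match_scalars <;> field_simp <;> ring
    · have h1 : 0 < 1 - t := by linarith
      have h2 : 1 / (1 - t) ≤ 1 := by rw [div_le_one h1]; linarith
      refine ⟨1 - t, h1, (1 / (1 - t)) • x + (1 - 1 / (1 - t)) • x₀,
        convex_mix hX hx hx₀ (by positivity) h2,
        (1 / (1 - t)) • x₀ + (1 - 1 / (1 - t)) • y₀,
        convex_mix hX hx₀ hy₀ (by positivity) h2, ?_⟩
      rw [he]
      match_scalars <;> field_simp <;> ring
  have lower_mono : ∀ (x : V) (t t' : ℝ), t' < t → x - x₀ - t • e ∈ K → x - x₀ - t' • e ∈ K := by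
    intro x t t' h hK
    convert K_add _ hK _ (K_smul _ heK (t - t') (by linarith)) using 1
    module
  have dichotomy : ∀ x ∈ X, ∀ t t' : ℝ, t < t' → x - x₀ - t • e ∈ K ∨ -(x - x₀ - t' • e) ∈ K := by
    intro x hx t t' h
    by_contra! hcon
    obtain ⟨h1, h2⟩ := hcon
    obtain ⟨c, hc, p, hp, q, hq, hpq⟩ := diff_form x hx t
    refine h2 ?_
    have hn : ¬ P p q := fun hP => h1 (hpq ▸ K_smul _ ((K_iff p hp q hq).1 hP) c hc)
    convert combine (t' - t) c (by linarith) hc x₀ hx₀ y₀ hy₀ q hq p hp h₀ hn using 1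
    rw [← neg_sub p q, smul_neg, ← hpq, ← he]
    module
  have exists_lower : ∀ x ∈ X, ∃ t : ℝ, x - x₀ - t • e ∈ K := by
    intro x hx
    obtain ⟨ε, hε, h⟩ := K_open e heK x hx x₀ hx₀
    refine ⟨-(1 / ε), ?_⟩
    convert K_smul _ h (1 / ε) (by positivity) using 1
    match_scalars <;> field_simp <;> ring
  have exists_upper : ∀ x ∈ X, ∃ t : ℝ, -(x - x₀ - t • e) ∈ K := by
    intro x hx
    obtain ⟨ε, hε, h⟩ := K_open e heK x₀ hx₀ x hx
    refine ⟨1 / ε, ?_⟩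
    convert K_smul _ h (1 / ε) (by positivity) using 1
    match_scalars <;> field_simp <;> ring
  let u : V → ℝ := fun x => sSup {t : ℝ | x - x₀ - t • e ∈ K}
  have bdd : ∀ x ∈ X, BddAbove {t : ℝ | x - x₀ - t • e ∈ K} := by
    intro x hx
    obtain ⟨b, hb⟩ := exists_upper x hx
    refine ⟨b, fun t ht => ?_⟩
    by_contra! hlt
    exact K_neg _ (lower_mono x t b hlt ht) hb
  have lt_u : ∀ x ∈ X, ∀ t : ℝ, t < u x → x - x₀ - t • e ∈ K := by
    intro x hx t ht
    obtain ⟨t', ht', hlt⟩ := exists_lt_of_lt_csSup (exists_lower x hx) ht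
    exact lower_mono x t' t hlt ht'
  have u_lt : ∀ x ∈ X, ∀ t : ℝ, u x < t → -(x - x₀ - t • e) ∈ K := by
    intro x hx t ht
    obtain ⟨t', h1, h2⟩ := exists_between ht
    rcases dichotomy x hx t' t h2 with h | h
    · exact absurd (le_csSup (bdd x hx) h) (not_le.2 h1)
    · exact h
  have le_u : ∀ x ∈ X, ∀ t : ℝ, x - x₀ - t • e ∈ K → t ≤ u x := fun x hx t ht => le_csSup (bdd x hx) ht
  have u_le : ∀ x ∈ X, ∀ t : ℝ, -(x - x₀ - t • e) ∈ K → u x ≤ t := by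
    intro x hx t ht
    by_contra! hlt
    exact K_neg _ (lt_u x hx t hlt) ht
  refine ⟨u, ?_, ?_⟩
  · intro x hx y hy α h0 h1
    have hm := convex_mix hX hx hy h0 h1
    rcases h0.eq_or_lt with rfl | h0
    · simp
    rcases h1.eq_or_lt with rfl | h1
    · simp
    refine le_antisymm ?_ ?_
    · refine le_of_forall_pos_le_add fun ε hε => u_le _ hm _ ?_
      have hK1 := K_smul _ (u_lt x hx (u x + ε) (by linarith)) α h0
      have hK2 := K_smul _ (u_lt y hy (u y + ε) (by linarith)) (1 - α) (by linarith)
      convert K_add _ hK1 _ hK2 using 1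
      module
    · refine le_of_forall_sub_le fun ε hε => le_u _ hm _ ?_
      have hK1 := K_smul _ (lt_u x hx (u x - ε) (by linarith)) α h0
      have hK2 := K_smul _ (lt_u y hy (u y - ε) (by linarith)) (1 - α) (by linarith)
      convert K_add _ hK1 _ hK2 using 1
      module
  · intro x hx y hy
    rw [K_iff x hx y hy]
    constructor
    · intro h
      obtain ⟨ε, hε, h'⟩ := K_open _ h y₀ hy₀ x₀ hx₀
      have hK := lt_u y hy (u y - ε / 2) (by linarith)
      have := le_u x hx (u y + ε / 2) (by
        convert K_add _ h' _ hK using 1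
        rw [he]
        module)
      linarith
    · intro h
      obtain ⟨t, h1, h2⟩ := exists_between h
      convert K_add _ (lt_u x hx t h2) _ (u_lt y hy t h1) using 1
      module

/-- Two affine functions on a convex set inducing the same order, one of them non-constant,
differ by a positive affine transformation. -/
theorem affine_unique {X : Set V} (hX : Convex ℝ X) {u u' : V → ℝ} (hu : IsAffineOn u X)
    (hu' : IsAffineOn u' X) (hn : NonConstOn u X)
    (h : ∀ x ∈ X, ∀ y ∈ X, (u y < u x ↔ u' y < u' x)) :
    ∃ a : ℝ, 0 < a ∧ ∃ b : ℝ, ∀ x ∈ X, u' x = a * u x + b := by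
  have heq : ∀ x ∈ X, ∀ y ∈ X, u x = u y → u' x = u' y := fun x hx y hy hxy =>
    le_antisymm (not_lt.1 fun hlt => absurd ((h x hx y hy).2 hlt) (by simp [hxy]))
      (not_lt.1 fun hlt => absurd ((h y hy x hx).2 hlt) (by simp [hxy]))
  have between : ∀ x ∈ X, ∀ y ∈ X, ∀ z ∈ X, u x ≤ u y → u y ≤ u z → u x < u z →
      (u z - u x) * u' y = (u y - u x) * u' z + (u z - u y) * u' x := by
    intro x hx y hy z hz hxy hyz hxz
    have hpos : 0 < u z - u x := by linarith
    set t := (u y - u x) / (u z - u x) with ht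
    have htm : t * (u z - u x) = u y - u x := by rw [ht]; field_simp
    have ht0 : 0 ≤ t := div_nonneg (by linarith) hpos.le
    have ht1 : t ≤ 1 := by rw [ht, div_le_one hpos]; linarith
    have hm := convex_mix hX hz hx ht0 ht1
    have := heq y hy _ hm (by rw [hu z hz x hx t ht0 ht1]; linarith)
    rw [this, hu' z hz x hx t ht0 ht1]
    linear_combination (u' z - u' x) * htm
  obtain ⟨x₀, hx₀, y₀, hy₀, hlt⟩ : ∃ x ∈ X, ∃ y ∈ X, u y < u x := by
    obtain ⟨x, hx, y, hy, hne⟩ := hn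
    rcases hne.lt_or_gt with hlt | hlt
    · exact ⟨y, hy, x, hx, hlt⟩
    · exact ⟨x, hx, y, hy, hlt⟩
  have hlt' := (h _ hx₀ _ hy₀).1 hlt
  have hpos : 0 < u x₀ - u y₀ := by linarith
  refine ⟨(u' x₀ - u' y₀) / (u x₀ - u y₀), div_pos (by linarith) hpos,
    u' y₀ - (u' x₀ - u' y₀) / (u x₀ - u y₀) * u y₀, fun x hx => ?_⟩
  have key : (u x₀ - u y₀) * u' x = (u' x₀ - u' y₀) * (u x - u y₀) + u' y₀ * (u x₀ - u y₀) := by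
    rcases le_total (u x) (u y₀) with h1 | h1
    · linear_combination -between x hx y₀ hy₀ x₀ hx₀ h1 hlt.le (h1.trans_lt hlt)
    · rcases le_total (u x) (u x₀) with h2 | h2
      · linear_combination between y₀ hy₀ x hx x₀ hx₀ h1 h2 hlt
      · linear_combination -between y₀ hy₀ x₀ hx₀ x hx hlt.le h2 (hlt.trans_le h2)
  field_simp
  linear_combination key

end Utility

section ActFunctionals

variable {S : Type*} [MeasurableSpace S] {V : Type*}

/-- An act, viewed as a simple function. -/
def IsAct.toSimpleFunc {X : Set V} {f : S → V} (hf : IsAct X f) : SimpleFunc S V :=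
  ⟨f, hf.2.2, hf.2.1⟩

/-- The utility profile of an act. -/
def IsAct.utility {X : Set V} {f : S → V} (hf : IsAct X f) (u : V → ℝ) : SimpleFunc S ℝ :=
  hf.toSimpleFunc.map u

theorem IsAct.utility_apply {X : Set V} {f : S → V} (hf : IsAct X f) (u : V → ℝ) (s : S) :
    hf.utility u s = u (f s) := rfl

theorem isAct_of_simpleFunc {X : Set V} (F : SimpleFunc S V) (h : ∀ s, F s ∈ X) : IsAct X F :=
  ⟨h, F.finite_range, F.measurableSet_fiber⟩

theorem isAct_constAct {X : Set V} {x : V} (hx : x ∈ X) : IsAct X (constAct S x) :=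
  isAct_of_simpleFunc (SimpleFunc.const S x) fun _ => hx

theorem simpleFunc_exists_abs_le (φ : SimpleFunc S ℝ) : ∃ k : ℝ, 0 < k ∧ ∀ s, |φ s| ≤ k := by
  obtain ⟨k, hk⟩ := φ.exists_forall_norm_le
  exact ⟨max k 1, by positivity, fun s => (hk s).trans (le_max_left _ _)⟩

variable [AddCommGroup V] [Module ℝ V]

theorem IsAct.mix {X : Set V} (hX : Convex ℝ X) {f g : S → V} (hf : IsAct X f) (hg : IsAct X g)
    {α : ℝ} (h0 : 0 ≤ α) (h1 : α ≤ 1) : IsAct X (mixAct α f g) :=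
  isAct_of_simpleFunc (α • hf.toSimpleFunc + (1 - α) • hg.toSimpleFunc) fun s =>
    convex_mix hX (hf.1 s) (hg.1 s) h0 h1

theorem utility_mix {X : Set V} {u : V → ℝ} (hu : IsAffineOn u X) {f g : S → V}
    (hf : IsAct X f) (hg : IsAct X g) {α : ℝ} (h0 : 0 ≤ α) (h1 : α ≤ 1) (s : S) :
    u (mixAct α f g s) = α * u (f s) + (1 - α) * u (g s) :=
  hu _ (hf.1 s) _ (hg.1 s) α h0 h1

/-- Every simple function bounded by `k` is `k` times the utility profile of an act, if the
utility takes the values `1` and `-1`. -/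
theorem exists_act_of_abs_le {X : Set V} (hX : Convex ℝ X) {u : V → ℝ} (hu : IsAffineOn u X)
    {x₀ y₀ : V} (hx₀ : x₀ ∈ X) (hy₀ : y₀ ∈ X) (hux : u x₀ = 1) (huy : u y₀ = -1)
    (φ : SimpleFunc S ℝ) {k : ℝ} (hk : 0 < k) (h : ∀ s, |φ s| ≤ k) :
    ∃ f, IsAct X f ∧ ∀ s, φ s = k * u (f s) := by
  have hb : ∀ s, 0 ≤ (1 + φ s / k) / 2 ∧ (1 + φ s / k) / 2 ≤ 1 := fun s => by
    have h1 := abs_le.1 (h s)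
    have h2 : φ s / k ≤ 1 := (div_le_one hk).2 h1.2
    have h3 : -1 ≤ φ s / k := by rw [le_div_iff₀ hk]; linarith
    constructor <;> linarith
  refine ⟨φ.map fun r => ((1 + r / k) / 2) • x₀ + (1 - (1 + r / k) / 2) • y₀,
    isAct_of_simpleFunc _ fun s => convex_mix hX hx₀ hy₀ (hb s).1 (hb s).2, fun s => ?_⟩
  rw [SimpleFunc.map_apply, hu _ hx₀ _ hy₀ _ (hb s).1 (hb s).2, hux, huy]
  field_simp
  ring

/-- A monotone, certainty-affine and quasi-concave evaluation of acts is a worst-case expected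
utility. -/
theorem exists_minEU_eq {X : Set V} (hX : Convex ℝ X) {u : V → ℝ} (hu : IsAffineOn u X)
    {x₀ y₀ : V} (hx₀ : x₀ ∈ X) (hy₀ : y₀ ∈ X) (hux : u x₀ = 1) (huy : u y₀ = -1)
    {a : (S → V) → ℝ}
    (mono : ∀ f g, IsAct X f → IsAct X g → (∀ s, u (f s) ≤ u (g s)) → a f ≤ a g)
    (caff : ∀ f, IsAct X f → ∀ x ∈ X, ∀ α : ℝ, 0 < α → α < 1 →
      a (mixAct α f (constAct S x)) = α * a f + (1 - α) * u x)
    (qconc : ∀ f g, IsAct X f → IsAct X g → min (a f) (a g) ≤ a (mixAct (1 / 2) f g)) :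
    ∃ C : Set (MSet S → ℝ), C.Nonempty ∧ C ⊆ ProbCharges S ∧ IsCompact C ∧ Convex ℝ C ∧
      ∀ f, IsAct X f → minEU u C f = a f := by
  have hexists : ∀ (φ : SimpleFunc S ℝ) {k : ℝ}, 0 < k → (∀ s, |φ s| ≤ k) →
      ∃ f, IsAct X f ∧ ∀ s, φ s = k * u (f s) :=
    fun φ k hk h => exists_act_of_abs_le hX hu hx₀ hy₀ hux huy φ hk h
  have acongr : ∀ f g, IsAct X f → IsAct X g → (∀ s, u (f s) = u (g s)) → a f = a g :=
    fun f g hf hg h => le_antisymm (mono f g hf hg fun s => (h s).le)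
      (mono g f hg hf fun s => (h s).ge)
  set o : V := (1 / 2 : ℝ) • x₀ + (1 - 1 / 2 : ℝ) • y₀ with ho
  have hoX : o ∈ X := convex_mix hX hx₀ hy₀ (by norm_num) (by norm_num)
  have huo : u o = 0 := by
    rw [ho, hu _ hx₀ _ hy₀ _ (by norm_num) (by norm_num), hux, huy]
    norm_num
  have well_lt : ∀ k k' : ℝ, 0 < k → k < k' → ∀ f f', IsAct X f → IsAct X f' →
      (∀ s, k * u (f s) = k' * u (f' s)) → k * a f = k' * a f' := by
    intro k k' hk hkk f f' hf hf' h
    have hk' : 0 < k' := hk.trans hkk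
    have h0 : 0 < k / k' := by positivity
    have h1 : k / k' < 1 := (div_lt_one hk').2 hkk
    have ho' := isAct_constAct (S := S) hoX
    have := acongr f' _ hf' (hf.mix hX ho' h0.le h1.le) fun s => by
      rw [utility_mix hu hf ho' h0.le h1.le, constAct, huo]
      have := h s
      field_simp
      linarith
    rw [this, caff f hf o hoX _ h0 h1, huo]
    field_simp
    ring
  have well : ∀ k k' : ℝ, 0 < k → 0 < k' → ∀ f f', IsAct X f → IsAct X f' →
      (∀ s, k * u (f s) = k' * u (f' s)) → k * a f = k' * a f' := by
    intro k k' hk hk' f f' hf hf' h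
    rcases lt_trichotomy k k' with hlt | rfl | hlt
    · exact well_lt k k' hk hlt f f' hf hf' h
    · rw [acongr f f' hf hf' fun s => mul_left_cancel₀ hk.ne' (h s)]
    · exact (well_lt k' k hk' hlt f' f hf' hf fun s => (h s).symm).symm
  have hrep : ∀ φ : SimpleFunc S ℝ, ∃ r : ℝ, ∀ k : ℝ, 0 < k → ∀ f, IsAct X f →
      (∀ s, φ s = k * u (f s)) → r = k * a f := by
    intro φ
    obtain ⟨k, hk, hb⟩ := simpleFunc_exists_abs_le φ
    obtain ⟨f, hf, h⟩ := hexists φ hk hb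
    exact ⟨k * a f, fun k' hk' f' hf' h' =>
      well k k' hk hk' f f' hf hf' fun s => by rw [← h, h']⟩
  choose I hI using hrep
  have Imono : ∀ φ ψ : SimpleFunc S ℝ, (∀ s, φ s ≤ ψ s) → I φ ≤ I ψ := by
    intro φ ψ h
    obtain ⟨k, hk, hb⟩ := simpleFunc_exists_abs_le φ
    obtain ⟨k', hk', hb'⟩ := simpleFunc_exists_abs_le ψ
    have hpos : 0 < k + k' := by linarith
    obtain ⟨f, hf, hfφ⟩ := hexists φ hpos fun s => (hb s).trans (by linarith)
    obtain ⟨g, hg, hgψ⟩ := hexists ψ hpos fun s => (hb' s).trans (by linarith)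
    rw [hI φ _ hpos f hf hfφ, hI ψ _ hpos g hg hgψ]
    refine mul_le_mul_of_nonneg_left (mono f g hf hg fun s => ?_) hpos.le
    have := h s
    rw [hfφ, hgψ] at this
    exact le_of_mul_le_mul_left this hpos
  have Ihom : ∀ (c : ℝ) (φ : SimpleFunc S ℝ), 0 < c → I (c • φ) = c * I φ := by
    intro c φ hc
    obtain ⟨k, hk, hb⟩ := simpleFunc_exists_abs_le φ
    obtain ⟨f, hf, hfφ⟩ := hexists φ hk hb
    rw [hI φ k hk f hf hfφ, hI (c • φ) (c * k) (by positivity) f hf fun s => by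
      rw [SimpleFunc.smul_apply, smul_eq_mul, hfφ, mul_assoc]]
    ring
  have Itrans : ∀ (φ : SimpleFunc S ℝ) (b : ℝ), I (φ + SimpleFunc.const S b) = I φ + b := by
    intro φ b
    obtain ⟨k₀, hk₀, hb⟩ := simpleFunc_exists_abs_le φ
    set k := k₀ + |b| with hkdef
    have hbn := abs_nonneg b
    have hk : 0 < k := by linarith
    obtain ⟨f, hf, hfφ⟩ := hexists φ hk fun s => (hb s).trans (by linarith)
    have hbk := abs_le.1 (show |b| ≤ k by linarith)
    have h0 : 0 ≤ (1 + b / k) / 2 := by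
      have : -1 ≤ b / k := by rw [le_div_iff₀ hk]; linarith
      linarith
    have h1 : (1 + b / k) / 2 ≤ 1 := by
      have : b / k ≤ 1 := (div_le_one hk).2 hbk.2
      linarith
    have hzX := convex_mix hX hx₀ hy₀ h0 h1
    have huz := hu _ hx₀ _ hy₀ _ h0 h1
    set z := ((1 + b / k) / 2) • x₀ + (1 - (1 + b / k) / 2) • y₀
    have huz' : k * u z = b := by
      rw [huz, hux, huy]
      field_simp
      ring
    have hz := isAct_constAct (S := S) hzX
    rw [hI φ k hk f hf hfφ, hI (φ + SimpleFunc.const S b) (2 * k) (by positivity)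
      (mixAct (1 / 2) f (constAct S z)) (hf.mix hX hz (by norm_num) (by norm_num)) fun s => by
        rw [utility_mix hu hf hz (by norm_num) (by norm_num), SimpleFunc.coe_add, Pi.add_apply,
          hfφ, SimpleFunc.const_apply, constAct]
        linear_combination -huz',
      caff f hf z hzX _ (by norm_num) (by norm_num)]
    linear_combination huz'
  have Iquasi : ∀ φ ψ : SimpleFunc S ℝ, 2 * min (I φ) (I ψ) ≤ I (φ + ψ) := by
    intro φ ψ
    obtain ⟨k, hk, hb⟩ := simpleFunc_exists_abs_le φ
    obtain ⟨k', hk', hb'⟩ := simpleFunc_exists_abs_le ψ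
    have hpos : 0 < k + k' := by linarith
    obtain ⟨f, hf, hfφ⟩ := hexists φ hpos fun s => (hb s).trans (by linarith)
    obtain ⟨g, hg, hgψ⟩ := hexists ψ hpos fun s => (hb' s).trans (by linarith)
    rw [hI φ _ hpos f hf hfφ, hI ψ _ hpos g hg hgψ, hI (φ + ψ) (2 * (k + k')) (by positivity)
      (mixAct (1 / 2) f g) (hf.mix hX hg (by norm_num) (by norm_num)) fun s => by
        rw [utility_mix hu hf hg (by norm_num) (by norm_num), SimpleFunc.coe_add, Pi.add_apply,
          hfφ, hgψ]
        ring, ← mul_min_of_nonneg _ _ hpos.le, ← mul_assoc]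
    exact mul_le_mul_of_nonneg_left (qconc f g hf hg) (by positivity)
  have Isuper : ∀ φ ψ, I φ + I ψ ≤ I (φ + ψ) := by
    intro φ ψ
    have h := Iquasi (φ + SimpleFunc.const S (-I φ)) (ψ + SimpleFunc.const S (-I ψ))
    rw [Itrans, Itrans, add_neg_cancel, add_neg_cancel, min_self, mul_zero,
      show φ + SimpleFunc.const S (-I φ) + (ψ + SimpleFunc.const S (-I ψ)) =
        φ + ψ + SimpleFunc.const S (-I φ + -I ψ) by ext s; simp; ring, Itrans] at h
    linarith
  obtain ⟨C, hCne, hCp, hCc, hCv, hC⟩ := exists_charges_isLeast Imono Ihom Itrans Isuper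
  refine ⟨C, hCne, hCp, hCc, hCv, fun f hf => ?_⟩
  have := (hC (hf.utility u)).csInf_eq
  rw [hI (hf.utility u) 1 one_pos f hf fun s => by rw [hf.utility_apply, one_mul], one_mul] at this
  exact this

end ActFunctionals

section WorstCase

variable {S : Type*} [MeasurableSpace S] {V : Type*}
variable {X : Set V} {u : V → ℝ} {p : MSet S → ℝ} {C D : Set (MSet S → ℝ)} {f g : S → V}

theorem EU_eq_chargeInt (hf : IsAct X f) (hp : p ∈ ProbCharges S) :
    EU u f p = chargeInt hp (hf.utility u) := rfl

theorem EU_affine (hf : IsAct X f) (hp : p ∈ ProbCharges S) {φ : SimpleFunc S ℝ}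
    {a b : ℝ} (h : ∀ s, φ s = a * u (f s) + b) : fInt p φ = a * EU u f p + b := by
  rw [← chargeInt_apply hp, EU_eq_chargeInt hf hp, ← smul_eq_mul, ← map_smul,
    ← chargeInt_const hp b, ← map_add]
  congr 1
  ext s
  simp [h, hf.utility_apply]

theorem EU_neg (hf : IsAct X f) (hp : p ∈ ProbCharges S) :
    EU (fun v => -u v) f p = -EU u f p := by
  have := EU_affine (u := u) hf hp (φ := hf.utility fun v => -u v) (a := -1) (b := 0)
    fun s => by rw [hf.utility_apply]; ring
  rw [neg_one_mul, add_zero] at this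
  exact this

theorem EU_const {x : V} (hx : x ∈ X) (hp : p ∈ ProbCharges S) : EU u (constAct S x) p = u x := by
  rw [EU_eq_chargeInt (isAct_constAct hx) hp]
  exact chargeInt_const hp (u x)

theorem EU_mono (hf : IsAct X f) (hg : IsAct X g) (hp : p ∈ ProbCharges S)
    (h : ∀ s, u (f s) ≤ u (g s)) : EU u f p ≤ EU u g p :=
  chargeInt_mono hp (φ := hf.utility u) (ψ := hg.utility u) h

theorem exists_min_simpleFunc [Nonempty S] (φ : SimpleFunc S ℝ) : ∃ s, ∀ t, φ s ≤ φ t := by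
  obtain ⟨_, ⟨s, rfl⟩, hs⟩ :=
    Set.exists_min_image (Set.range φ) id φ.finite_range (Set.range_nonempty _)
  exact ⟨s, fun t => hs _ ⟨t, rfl⟩⟩

theorem exists_max_simpleFunc [Nonempty S] (φ : SimpleFunc S ℝ) : ∃ s, ∀ t, φ t ≤ φ s := by
  obtain ⟨s, hs⟩ := exists_min_simpleFunc (-φ)
  exact ⟨s, fun t => by simpa using hs t⟩

theorem EU_strictMono [Nonempty S] (hf : IsAct X f) (hg : IsAct X g) (hp : p ∈ ProbCharges S)
    (h : ∀ s, u (f s) < u (g s)) : EU u f p < EU u g p := by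
  obtain ⟨s, hs⟩ := exists_min_simpleFunc (hg.utility u - hf.utility u)
  have := chargeInt_mono hp hs (φ := SimpleFunc.const S ((hg.utility u - hf.utility u) s))
  rw [chargeInt_const, map_sub, SimpleFunc.coe_sub, Pi.sub_apply, IsAct.utility_apply,
    IsAct.utility_apply] at this
  rw [EU_eq_chargeInt hf hp, EU_eq_chargeInt hg hp]
  linarith [h s]

theorem isLeast_minEU (hC : IsCompact C) (hne : C.Nonempty) (hf : IsAct X f) :
    IsLeast (EU u f '' C) (minEU u C f) :=
  (hC.image (continuous_fInt (hf.utility u))).isLeast_sInf (hne.image _)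

theorem exists_EU_eq_minEU (hC : IsCompact C) (hne : C.Nonempty) (hf : IsAct X f) :
    ∃ p ∈ C, EU u f p = minEU u C f :=
  (isLeast_minEU hC hne hf).1

theorem minEU_le (hC : IsCompact C) (hf : IsAct X f) (hp : p ∈ C) : minEU u C f ≤ EU u f p :=
  (isLeast_minEU hC ⟨p, hp⟩ hf).2 ⟨p, hp, rfl⟩

theorem maxEU_eq_neg_minEU (hD : D ⊆ ProbCharges S) (hf : IsAct X f) :
    maxEU u D f = -minEU (fun v => -u v) D f := by
  have : EU (fun v => -u v) f '' D = -(EU u f '' D) := by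
    rw [← Set.image_neg_eq_neg, Set.image_image]
    exact Set.image_congr fun p hp => EU_neg hf (hD hp)
  rw [minEU, this, Real.sInf_def, neg_neg, neg_neg, maxEU]

theorem minEU_neg_eq_neg_maxEU (hD : D ⊆ ProbCharges S) (hf : IsAct X f) :
    minEU (fun v => -u v) D f = -maxEU u D f := by
  rw [maxEU_eq_neg_minEU hD hf, neg_neg]

theorem maxEU_neg_eq_neg_minEU (hD : D ⊆ ProbCharges S) (hf : IsAct X f) :
    maxEU (fun v => -u v) D f = -minEU u D f := by
  rw [maxEU_eq_neg_minEU hD hf]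
  simp only [neg_neg]

theorem le_maxEU (hD : IsCompact D) (hDp : D ⊆ ProbCharges S) (hf : IsAct X f) (hp : p ∈ D) :
    EU u f p ≤ maxEU u D f := by
  have := minEU_le (u := fun v => -u v) hD hf hp
  rw [EU_neg hf (hDp hp), minEU_neg_eq_neg_maxEU hDp hf] at this
  linarith

theorem minEU_le_maxEU (hC : IsCompact C) (hD : IsCompact D) (hDp : D ⊆ ProbCharges S)
    (hCD : (C ∩ D).Nonempty) (hf : IsAct X f) : minEU u C f ≤ maxEU u D f := by
  obtain ⟨p, hpC, hpD⟩ := hCD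
  exact (minEU_le hC hf hpC).trans (le_maxEU hD hDp hf hpD)

theorem minEU_const (hCp : C ⊆ ProbCharges S) (hC : IsCompact C) (hne : C.Nonempty) {x : V}
    (hx : x ∈ X) : minEU u C (constAct S x) = u x := by
  obtain ⟨p, hp, h⟩ := exists_EU_eq_minEU (u := u) hC hne (isAct_constAct hx)
  rw [← h, EU_const hx (hCp hp)]

theorem maxEU_const (hDp : D ⊆ ProbCharges S) (hD : IsCompact D) (hne : D.Nonempty) {x : V}
    (hx : x ∈ X) : maxEU u D (constAct S x) = u x := by
  rw [maxEU_eq_neg_minEU hDp (isAct_constAct hx), minEU_const hDp hD hne hx, neg_neg]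

theorem minEU_strictMono [Nonempty S] (hCp : C ⊆ ProbCharges S) (hC : IsCompact C)
    (hne : C.Nonempty) (hf : IsAct X f) (hg : IsAct X g) (h : ∀ s, u (f s) < u (g s)) :
    minEU u C f < minEU u C g := by
  obtain ⟨p, hp, hpg⟩ := exists_EU_eq_minEU (u := u) hC hne hg
  rw [← hpg]
  exact (minEU_le hC hf hp).trans_lt (EU_strictMono hf hg (hCp hp) h)

theorem minEU_affine (hCp : C ⊆ ProbCharges S) (hC : IsCompact C) (hne : C.Nonempty)
    (hf : IsAct X f) {u' : V → ℝ} {a b : ℝ} (ha : 0 < a) (h : ∀ x ∈ X, u' x = a * u x + b) :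
    minEU u' C f = a * minEU u C f + b := by
  have hEU : ∀ p ∈ C, EU u' f p = a * EU u f p + b := fun p hp =>
    EU_affine (φ := hf.utility u') hf (hCp hp) fun s => h _ (hf.1 s)
  refine le_antisymm ?_ ?_
  · obtain ⟨p, hp, hpe⟩ := exists_EU_eq_minEU (u := u) hC hne hf
    rw [← hpe, ← hEU p hp]
    exact minEU_le hC hf hp
  · obtain ⟨p, hp, hpe⟩ := exists_EU_eq_minEU (u := u') hC hne hf
    rw [← hpe, hEU p hp]
    have := minEU_le (u := u) hC hf hp
    gcongr

theorem NonConstOn.exists_lt (hn : NonConstOn u X) : ∃ x ∈ X, ∃ y ∈ X, u y < u x := by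
  obtain ⟨x, hx, y, hy, hne⟩ := hn
  rcases hne.lt_or_gt with hlt | hlt
  · exact ⟨y, hy, x, hx, hlt⟩
  · exact ⟨x, hx, y, hy, hlt⟩

variable [AddCommGroup V] [Module ℝ V]

theorem IsAffineOn.neg {X : Set V} {u : V → ℝ} (hu : IsAffineOn u X) :
    IsAffineOn (fun v => -u v) X := fun x hx y hy α h0 h1 => by
  simp only [hu x hx y hy α h0 h1]
  ring

/-- The image of an affine function on a convex set is an interval. -/
theorem IsAffineOn.exists_eq {X : Set V} (hX : Convex ℝ X) {u : V → ℝ} (hu : IsAffineOn u X)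
    {x y : V} (hx : x ∈ X) (hy : y ∈ X) {r : ℝ} (h1 : u x ≤ r) (h2 : r ≤ u y) :
    ∃ z ∈ X, u z = r := by
  rcases h1.eq_or_lt with rfl | h1
  · exact ⟨x, hx, rfl⟩
  have hpos : 0 < u y - u x := by linarith
  have h0 : 0 ≤ (r - u x) / (u y - u x) := div_nonneg (by linarith) hpos.le
  have h1 : (r - u x) / (u y - u x) ≤ 1 := (div_le_one hpos).2 (by linarith)
  refine ⟨_, convex_mix hX hy hx h0 h1, ?_⟩
  rw [hu y hy x hx _ h0 h1]
  field_simp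
  ring

theorem EU_mix (hX : Convex ℝ X) (hu : IsAffineOn u X) (hf : IsAct X f) (hg : IsAct X g)
    (hp : p ∈ ProbCharges S) {α : ℝ} (h0 : 0 ≤ α) (h1 : α ≤ 1) :
    EU u (mixAct α f g) p = α * EU u f p + (1 - α) * EU u g p := by
  rw [EU_eq_chargeInt hf hp, EU_eq_chargeInt hg hp, EU_eq_chargeInt (hf.mix hX hg h0 h1) hp,
    ← smul_eq_mul, ← smul_eq_mul, ← map_smul, ← map_smul, ← map_add]
  congr 1
  ext s
  simp [IsAct.utility_apply, utility_mix hu hf hg h0 h1]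

theorem EU_mem_image [Nonempty S] (hX : Convex ℝ X) (hu : IsAffineOn u X) (hf : IsAct X f)
    (hp : p ∈ ProbCharges S) : ∃ x ∈ X, u x = EU u f p := by
  obtain ⟨s, hs⟩ := exists_min_simpleFunc (hf.utility u)
  obtain ⟨t, ht⟩ := exists_max_simpleFunc (hf.utility u)
  refine hu.exists_eq hX (hf.1 s) (hf.1 t) ?_ ?_
  · rw [← EU_const (u := u) (hf.1 s) hp]
    exact EU_mono (isAct_constAct (hf.1 s)) hf hp hs
  · rw [← EU_const (u := u) (hf.1 t) hp]
    exact EU_mono hf (isAct_constAct (hf.1 t)) hp ht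

theorem minEU_mem_image [Nonempty S] (hX : Convex ℝ X) (hu : IsAffineOn u X)
    (hCp : C ⊆ ProbCharges S) (hC : IsCompact C) (hne : C.Nonempty) (hf : IsAct X f) :
    ∃ x ∈ X, u x = minEU u C f := by
  obtain ⟨p, hp, h⟩ := exists_EU_eq_minEU (u := u) hC hne hf
  rw [← h]
  exact EU_mem_image hX hu hf (hCp hp)

theorem maxEU_mem_image [Nonempty S] (hX : Convex ℝ X) (hu : IsAffineOn u X)
    (hDp : D ⊆ ProbCharges S) (hD : IsCompact D) (hne : D.Nonempty) (hf : IsAct X f) :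
    ∃ x ∈ X, u x = maxEU u D f := by
  obtain ⟨x, hx, h⟩ := minEU_mem_image hX hu.neg hDp hD hne hf
  exact ⟨x, hx, by rw [maxEU_eq_neg_minEU hDp hf, ← h, neg_neg]⟩

theorem minEU_concave (hX : Convex ℝ X) (hu : IsAffineOn u X) (hCp : C ⊆ ProbCharges S)
    (hC : IsCompact C) (hne : C.Nonempty) (hf : IsAct X f) (hg : IsAct X g) {α : ℝ} (h0 : 0 ≤ α)
    (h1 : α ≤ 1) :
    α * minEU u C f + (1 - α) * minEU u C g ≤ minEU u C (mixAct α f g) := by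
  obtain ⟨p, hp, h⟩ := exists_EU_eq_minEU (u := u) hC hne (hf.mix hX hg h0 h1)
  rw [← h, EU_mix hX hu hf hg (hCp hp) h0 h1]
  have h1' : 0 ≤ 1 - α := by linarith
  have h2 := minEU_le (u := u) hC hf hp
  have h3 := minEU_le (u := u) hC hg hp
  gcongr

theorem minEU_mix_const (hX : Convex ℝ X) (hu : IsAffineOn u X) (hCp : C ⊆ ProbCharges S)
    (hC : IsCompact C) (hne : C.Nonempty) (hf : IsAct X f) {x : V} (hx : x ∈ X) {α : ℝ}
    (h0 : 0 ≤ α) (h1 : α ≤ 1) :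
    minEU u C (mixAct α f (constAct S x)) = α * minEU u C f + (1 - α) * u x := by
  have hc := isAct_constAct (S := S) hx
  refine le_antisymm ?_ ?_
  · obtain ⟨p, hp, h⟩ := exists_EU_eq_minEU (u := u) hC hne hf
    rw [← h, ← EU_const (u := u) hx (hCp hp), ← EU_mix hX hu hf hc (hCp hp) h0 h1]
    exact minEU_le hC (hf.mix hX hc h0 h1) hp
  · have := minEU_concave hX hu hCp hC hne hf hc h0 h1
    rwa [minEU_const hCp hC hne hx] at this

theorem maxEU_mix_const (hX : Convex ℝ X) (hu : IsAffineOn u X) (hDp : D ⊆ ProbCharges S)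
    (hD : IsCompact D) (hne : D.Nonempty) (hf : IsAct X f) {x : V} (hx : x ∈ X) {α : ℝ}
    (h0 : 0 ≤ α) (h1 : α ≤ 1) :
    maxEU u D (mixAct α f (constAct S x)) = α * maxEU u D f + (1 - α) * u x := by
  rw [maxEU_eq_neg_minEU hDp hf, maxEU_eq_neg_minEU hDp (hf.mix hX (isAct_constAct hx) h0 h1),
    minEU_mix_const hX hu.neg hDp hD hne hf hx h0 h1]
  ring

theorem continuous_minEU_mix (hX : Convex ℝ X) (hu : IsAffineOn u X) (hCp : C ⊆ ProbCharges S)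
    (hC : IsCompact C) (hne : C.Nonempty) (hf : IsAct X f) (hg : IsAct X g) :
    Continuous fun α : Set.Icc (0 : ℝ) 1 => minEU u C (mixAct (α : ℝ) f g) := by
  obtain ⟨M, hM⟩ := (hC.image (f := fun p => EU u f p - EU u g p)
    ((continuous_fInt (hf.utility u)).sub (continuous_fInt (hg.utility u)))).isBounded.exists_norm_le
  have hM' : ∀ p ∈ C, |EU u f p - EU u g p| ≤ M := fun p hp => hM _ ⟨p, hp, rfl⟩
  have hM0 : 0 ≤ M := by
    obtain ⟨p, hp⟩ := hne
    exact (abs_nonneg _).trans (hM' p hp)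
  have hact : ∀ α : Set.Icc (0 : ℝ) 1, IsAct X (mixAct (α : ℝ) f g) :=
    fun α => hf.mix hX hg α.2.1 α.2.2
  refine (LipschitzWith.of_le_add_mul (M.toNNReal) fun α β => ?_).continuous
  obtain ⟨p, hp, h⟩ := exists_EU_eq_minEU (u := u) hC hne (hact β)
  have h1 := minEU_le (u := u) hC (hact α) hp
  rw [EU_mix hX hu hf hg (hCp hp) α.2.1 α.2.2] at h1
  rw [← h, EU_mix hX hu hf hg (hCp hp) β.2.1 β.2.2, Real.coe_toNNReal _ hM0, Subtype.dist_eq,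
    Real.dist_eq]
  have h2 : ((α : ℝ) - β) * (EU u f p - EU u g p) ≤ M * |(α : ℝ) - β| := by
    refine (le_abs_self _).trans ?_
    rw [abs_mul, mul_comm]
    exact mul_le_mul_of_nonneg_right (hM' p hp) (abs_nonneg _)
  linarith

theorem continuous_maxEU_mix (hX : Convex ℝ X) (hu : IsAffineOn u X) (hDp : D ⊆ ProbCharges S)
    (hD : IsCompact D) (hne : D.Nonempty) (hf : IsAct X f) (hg : IsAct X g) :
    Continuous fun α : Set.Icc (0 : ℝ) 1 => maxEU u D (mixAct (α : ℝ) f g) := by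
  have h : (fun α : Set.Icc (0 : ℝ) 1 => maxEU u D (mixAct (α : ℝ) f g)) =
      fun α : Set.Icc (0 : ℝ) 1 => -minEU (fun v => -u v) D (mixAct (α : ℝ) f g) :=
    funext fun α => maxEU_eq_neg_minEU hDp (hf.mix hX hg α.2.1 α.2.2)
  rw [h]
  exact (continuous_minEU_mix hX hu.neg hDp hD hne hf hg).neg

/-- A non-constant affine function can be normalized to take the values `1` and `-1`. -/
theorem exists_normalized (hu : IsAffineOn u X) {x₀ y₀ : V} (hlt : u y₀ < u x₀) :
    ∃ a : ℝ, 0 < a ∧ ∃ b : ℝ, a * u x₀ + b = 1 ∧ a * u y₀ + b = -1 ∧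
      IsAffineOn (fun v => a * u v + b) X := by
  have hpos : 0 < u x₀ - u y₀ := by linarith
  refine ⟨2 / (u x₀ - u y₀), by positivity, 1 - 2 / (u x₀ - u y₀) * u x₀, by ring, ?_, ?_⟩
  · field_simp
    ring
  · intro x hx y hy α h0 h1
    simp only [hu x hx y hy α h0 h1]
    ring

/-- Disjoint compact convex sets of probabilities are strictly separated by the expected utility
of an act. -/
theorem exists_act_separating (hX : Convex ℝ X) (hu : IsAffineOn u X) (hn : NonConstOn u X)
    (hCp : C ⊆ ProbCharges S) (hDp : D ⊆ ProbCharges S) (hC : IsCompact C) (hD : IsCompact D)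
    (hCv : Convex ℝ C) (hDv : Convex ℝ D) (hCD : Disjoint C D) :
    ∃ f, IsAct X f ∧ ∃ r, (∀ p ∈ C, EU u f p < r) ∧ ∀ q ∈ D, r < EU u f q := by
  obtain ⟨φ, r, h1, h2⟩ := exists_simpleFunc_separating hCp hDp hC hD hCv hDv hCD
  obtain ⟨x₀, hx₀, y₀, hy₀, hlt⟩ := hn.exists_lt
  obtain ⟨a, ha, b, hx, hy, haff⟩ := exists_normalized hu hlt
  obtain ⟨k, hk, hb⟩ := simpleFunc_exists_abs_le φ
  obtain ⟨f, hf, hφ⟩ := exists_act_of_abs_le hX haff hx₀ hy₀ hx hy φ hk hb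
  have key : ∀ p ∈ ProbCharges S, fInt p φ = k * a * EU u f p + k * b := fun p hp =>
    EU_affine hf hp fun s => by rw [hφ]; ring
  have hka : 0 < k * a := by positivity
  refine ⟨f, hf, (r - k * b) / (k * a), fun p hp => ?_, fun q hq => ?_⟩
  · rw [lt_div_iff₀ hka]
    have := h1 p hp
    rw [key p (hCp hp)] at this
    linarith
  · rw [div_lt_iff₀ hka]
    have := h2 q hq
    rw [key q (hDp hq)] at this
    linarith

end WorstCase

section Representation

variable {S : Type*} [MeasurableSpace S] {V : Type*} [AddCommGroup V] [Module ℝ V]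
variable {X : Set V} {R : (S → V) → (S → V) → Prop} {u : V → ℝ} {C D : Set (MSet S → ℝ)}

theorem IsHPRep.flip (h : IsHPRep X R u C D) :
    IsHPRep X (fun f g => R g f) (fun v => -u v) D C := by
  obtain ⟨hu, ⟨x, hx, y, hy, hxy⟩, hCn, hDn, hCp, hDp, hC, hD, hCv, hDv, hCD, hR⟩ := h
  refine ⟨hu.neg, ⟨x, hx, y, hy, fun h => hxy (neg_injective h)⟩, hDn, hCn, hDp, hCp, hD, hC, hDv,
    hCv, by rwa [Set.inter_comm], fun f g hf hg => ?_⟩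
  refine (hR g f hg hf).trans ?_
  rw [minEU_neg_eq_neg_maxEU hDp hf, minEU_neg_eq_neg_maxEU hDp hg,
    maxEU_neg_eq_neg_minEU hCp hf, maxEU_neg_eq_neg_minEU hCp hg, neg_lt_neg_iff, neg_lt_neg_iff,
    and_comm]

theorem IsHPRep.lower_iff (h : IsHPRep X R u C D) {f : S → V} (hf : IsAct X f) {x : V}
    (hx : x ∈ X) : R f (constAct S x) ↔ u x < minEU u C f := by
  obtain ⟨hu, -, hCn, hDn, hCp, hDp, hC, hD, hCv, hDv, hCD, hR⟩ := h
  rw [hR _ _ hf (isAct_constAct hx), minEU_const hCp hC hCn hx, maxEU_const hDp hD hDn hx]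
  exact and_iff_left_of_imp fun h => h.trans_le (minEU_le_maxEU hC hD hDp hCD hf)

theorem IsHPRep.upper_iff (h : IsHPRep X R u C D) {f : S → V} (hf : IsAct X f) {x : V}
    (hx : x ∈ X) : R (constAct S x) f ↔ maxEU u D f < u x := by
  rw [h.flip.lower_iff hf hx, minEU_neg_eq_neg_maxEU h.2.2.2.2.2.1 hf, neg_lt_neg_iff]

theorem IsHPRep.const_iff [Nonempty S] (h : IsHPRep X R u C D) {x y : V} (hx : x ∈ X)
    (hy : y ∈ X) : R (constAct S x) (constAct S y) ↔ u y < u x := by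
  rw [h.lower_iff (isAct_constAct hx) hy, minEU_const h.2.2.2.2.1 h.2.2.2.2.2.2.1 h.2.2.1 hx]

theorem IsHPRep.convex_upper (h : IsHPRep X R u C D) (hX : Convex ℝ X) {x : V} (hx : x ∈ X)
    {f g : S → V} (hf : IsAct X f) (hg : IsAct X g) (h1 : R f (constAct S x))
    (h2 : R g (constAct S x)) {α : ℝ} (h0 : 0 ≤ α) (hα : α ≤ 1) :
    R (mixAct α f g) (constAct S x) := by
  rw [h.lower_iff hf hx] at h1
  rw [h.lower_iff hg hx] at h2
  rw [h.lower_iff (hf.mix hX hg h0 hα) hx]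
  refine lt_of_lt_of_le ?_ (minEU_concave hX h.1 h.2.2.2.2.1 h.2.2.2.2.2.2.1 h.2.2.1 hf hg h0 hα)
  rcases h0.eq_or_lt with rfl | h0
  · linarith
  · nlinarith

theorem IsHPRep.prefAx [Nonempty S] (hX : Convex ℝ X) (h : IsHPRep X R u C D) :
    PrefAx1 X R ∧ PrefAx2 X R ∧ PrefAx3 X R ∧ PrefAx4 X R ∧ PrefAx5 X R ∧ PrefAx6 X R ∧
      PrefAx7 X R := by
  have hrep := h
  obtain ⟨hu, hn, hCn, hDn, hCp, hDp, hC, hD, hCv, hDv, hCD, hR⟩ := h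
  refine ⟨⟨?_, ?_, ?_, ?_⟩, ?_, ?_, ?_, ?_, ?_, ?_⟩
  · intro f g hf hg h1 h2
    exact ((hR f g hf hg).1 h1).1.asymm ((hR g f hg hf).1 h2).1
  · intro f g h hf hg hh h1 h2
    rw [hR _ _ hf hg] at h1
    rw [hR _ _ hg hh] at h2
    exact (hR _ _ hf hh).2 ⟨h2.1.trans h1.1, h2.2.trans h1.2⟩
  · obtain ⟨x, hx, y, hy, hxy⟩ := hn.exists_lt
    exact ⟨x, hx, y, hy, (hrep.const_iff hx hy).2 hxy⟩
  · intro x hx y hy z hz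
    rw [hrep.const_iff hx hy, hrep.const_iff hy hz, hrep.const_iff hx hz, not_lt, not_lt, not_lt]
    exact le_trans
  · intro f g h hf hg hh
    have hmix : ∀ α : Set.Icc (0 : ℝ) 1, IsAct X (mixAct (α : ℝ) f g) := fun α =>
      hf.mix hX hg α.2.1 α.2.2
    have ha := continuous_minEU_mix hX hu hCp hC hCn hf hg
    have hb := continuous_maxEU_mix hX hu hDp hD hDn hf hg
    constructor
    · simp only [hR _ _ (hmix _) hh]
      exact (isOpen_lt continuous_const ha).inter (isOpen_lt continuous_const hb)
    · simp only [hR _ _ hh (hmix _)]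
      exact (isOpen_lt ha continuous_const).inter (isOpen_lt hb continuous_const)
  · intro f g hf hg x hx α h0 h1
    have hc := isAct_constAct (S := S) hx
    rw [hR _ _ hf hg, hR _ _ (hf.mix hX hc h0.le h1.le) (hg.mix hX hc h0.le h1.le),
      minEU_mix_const hX hu hCp hC hCn hf hx h0.le h1.le,
      minEU_mix_const hX hu hCp hC hCn hg hx h0.le h1.le,
      maxEU_mix_const hX hu hDp hD hDn hf hx h0.le h1.le,
      maxEU_mix_const hX hu hDp hD hDn hg hx h0.le h1.le, add_lt_add_iff_right,
      add_lt_add_iff_right, mul_lt_mul_iff_right₀ h0, mul_lt_mul_iff_right₀ h0]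
  · exact fun x hx =>
      ⟨fun f g hf hg h1 h2 α h0 hα => hrep.convex_upper hX hx hf hg h1 h2 h0 hα,
        fun f g hf hg h1 h2 α h0 hα => hrep.flip.convex_upper hX hx hf hg h1 h2 h0 hα⟩
  · intro f g hf hg hs
    have hs : ∀ s, u (g s) < u (f s) := fun s => (hrep.const_iff (hf.1 s) (hg.1 s)).1 (hs s)
    refine (hR f g hf hg).2 ⟨minEU_strictMono hCp hC hCn hg hf hs, ?_⟩
    rw [maxEU_eq_neg_minEU hDp hf, maxEU_eq_neg_minEU hDp hg, neg_lt_neg_iff]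
    exact minEU_strictMono hDp hD hDn hf hg fun s => neg_lt_neg (hs s)
  · intro f g hf hg hfg
    have hab : minEU u C f ≤ maxEU u D f := minEU_le_maxEU hC hD hDp hCD hf
    have key : ∀ x ∈ X, minEU u C f ≤ u x → u x ≤ maxEU u D f →
        minEU u C g ≤ u x ∧ u x ≤ maxEU u D g := fun x hx h1 h2 => by
      have := hfg x hx
      simpa only [Incomp, hrep.lower_iff hf hx, hrep.upper_iff hf hx, hrep.lower_iff hg hx,
        hrep.upper_iff hg hx, not_lt, h1, h2, true_and, forall_const] using this
    obtain ⟨x, hx, hxa⟩ := minEU_mem_image hX hu hCp hC hCn hf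
    obtain ⟨y, hy, hyb⟩ := maxEU_mem_image hX hu hDp hD hDn hf
    have h1 := (key x hx hxa.ge (hxa.trans_le hab)).1
    have h2 := (key y hy (hab.trans hyb.ge) hyb.le).2
    constructor
    · intro hc
      linarith [((hR f g hf hg).1 hc).2]
    · intro hc
      linarith [((hR g f hg hf).1 hc).1]
  · intro f g hf hg x hx y hy h1 h2 h3 h4
    rw [Incomp, hrep.lower_iff hf hx, hrep.upper_iff hf hx] at h1
    rw [Incomp, hrep.lower_iff hg hy, hrep.upper_iff hg hy] at h3
    rw [hrep.upper_iff hg hx] at h2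
    rw [hrep.lower_iff hf hy] at h4
    exact (hR f g hf hg).2 ⟨by linarith [h3.1], by linarith [h1.2]⟩

theorem subset_of_minEU_le (hX : Convex ℝ X) (hu : IsAffineOn u X) (hn : NonConstOn u X)
    (hCp : C ⊆ ProbCharges S) (hDp : D ⊆ ProbCharges S) (hC : IsCompact C) (hD : IsCompact D)
    (hCv : Convex ℝ C) (hCn : C.Nonempty) (h : ∀ f, IsAct X f → minEU u C f ≤ minEU u D f) :
    D ⊆ C := by
  intro p hp
  by_contra hpC
  obtain ⟨f, hf, r, h1, h2⟩ := exists_act_separating hX hu hn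
    (Set.singleton_subset_iff.2 (hDp hp)) hCp isCompact_singleton hC (convex_singleton p) hCv
    (Set.disjoint_singleton_left.2 hpC)
  obtain ⟨q, hq, hqf⟩ := exists_EU_eq_minEU (u := u) hC hCn hf
  linarith [h f hf, h1 p rfl, h2 q hq, minEU_le (u := u) hD hf hp]

theorem IsHPRep.exists_affine [Nonempty S] (hX : Convex ℝ X) {u' : V → ℝ}
    {C' D' : Set (MSet S → ℝ)} (h : IsHPRep X R u C D) (h' : IsHPRep X R u' C' D') :
    ∃ a : ℝ, 0 < a ∧ ∃ b : ℝ, ∀ x ∈ X, u' x = a * u x + b :=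
  affine_unique hX h.1 h'.1 h.2.1 fun x hx y hy => by
    rw [← h.const_iff hx hy, ← h'.const_iff hx hy]

theorem IsHPRep.lower_unique [Nonempty S] (hX : Convex ℝ X) {u' : V → ℝ}
    {C' D' : Set (MSet S → ℝ)} (h : IsHPRep X R u C D) (h' : IsHPRep X R u' C' D') : C' = C := by
  obtain ⟨a, ha, b, hab⟩ := h.exists_affine hX h'
  have hrep := h
  have hrep' := h'
  obtain ⟨hu, hn, hCn, -, hCp, -, hC, -, hCv, -⟩ := h
  obtain ⟨hu', hn', hCn', -, hCp', -, hC', -, hCv', -⟩ := h'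
  have key : ∀ f, IsAct X f → minEU u' C f = minEU u' C' f := by
    intro f hf
    have hiff : ∀ x ∈ X, u' x < minEU u' C f ↔ u' x < minEU u' C' f := fun x hx => by
      rw [← hrep'.lower_iff hf hx, hrep.lower_iff hf hx, minEU_affine hCp hC hCn hf ha hab,
        hab x hx, add_lt_add_iff_right, mul_lt_mul_iff_right₀ ha]
    obtain ⟨x, hx, h1⟩ := minEU_mem_image hX hu' hCp hC hCn hf
    obtain ⟨y, hy, h2⟩ := minEU_mem_image hX hu' hCp' hC' hCn' hf
    apply le_antisymm
    · have := hiff y hy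
      simpa [h2] using this
    · have := hiff x hx
      simpa [h1] using this
  exact (subset_of_minEU_le hX hu' hn' hCp hCp' hC hC' hCv hCn fun f hf => (key f hf).le).antisymm
    (subset_of_minEU_le hX hu' hn' hCp' hCp hC' hC hCv' hCn' fun f hf => (key f hf).ge)

end Representation

section Construction

variable {S : Type*} [MeasurableSpace S] {V : Type*} [AddCommGroup V] [Module ℝ V]
variable {X : Set V} {R : (S → V) → (S → V) → Prop}

theorem PrefAx2.flip (h : PrefAx2 X R) : PrefAx2 X fun f g => R g f :=
  fun f g k hf hg hk => (h f g k hf hg hk).symm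

theorem PrefAx2.exists_delta (h : PrefAx2 X R) {f g k : S → V} (hf : IsAct X f) (hg : IsAct X g)
    (hk : IsAct X k) (hfk : R f k) :
    ∃ δ : ℝ, 0 < δ ∧ δ < 1 ∧ ∀ ε, 0 < ε → ε ≤ δ → R (mixAct (1 - ε) f g) k := by
  have hone : mixAct 1 f g = f := by
    funext s
    simp [mixAct]
  obtain ⟨η, hη, hball⟩ := Metric.isOpen_iff.1 (h f g k hf hg hk).1 1
    (by simpa [hone] using hfk)
  refine ⟨min (η / 2) (1 / 2), by positivity, (min_le_right _ _).trans_lt (by norm_num),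
    fun ε h0 hε => ?_⟩
  have h1 : ε ≤ η / 2 := hε.trans (min_le_left _ _)
  have h2 : ε ≤ 1 / 2 := hε.trans (min_le_right _ _)
  refine @hball ⟨1 - ε, by linarith, by linarith⟩ ?_
  rw [Metric.mem_ball, Subtype.dist_eq, Real.dist_eq]
  simp only [Set.Icc.coe_one, sub_sub_cancel_left, abs_neg, abs_of_pos h0]
  linarith

theorem exists_utility_of_prefAx (hX : Convex ℝ X) (h1 : PrefAx1 X R) (h2 : PrefAx2 X R)
    (h3 : PrefAx3 X R) : ∃ u : V → ℝ, IsAffineOn u X ∧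
      ∀ x ∈ X, ∀ y ∈ X, (R (constAct S x) (constAct S y) ↔ u y < u x) := by
  obtain ⟨asymm, trans, nontriv, negtrans⟩ := h1
  have hc : ∀ {x}, x ∈ X → IsAct X (constAct S x) := fun hx => isAct_constAct hx
  refine exists_affine_utility hX (P := fun x y => R (constAct S x) (constAct S y))
    (fun x hx y hy => asymm _ _ (hc hx) (hc hy))
    (fun x hx y hy z hz => trans _ _ _ (hc hx) (hc hy) (hc hz)) negtrans nontriv
    (fun x hx y hy z hz α h0 hα => h3 _ _ (hc hx) (hc hy) z hz α h0 hα)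
    (fun x hx y hy z hz hxz => ?_) (fun x hx y hy z hz hxz => ?_)
  · obtain ⟨δ, h0, hδ, h⟩ := h2.exists_delta (hc hx) (hc hy) (hc hz) hxz
    refine ⟨δ, h0, hδ, fun ε hε hεδ => ?_⟩
    have := h ε hε hεδ
    unfold mixAct at this
    rwa [sub_sub_cancel] at this
  · obtain ⟨δ, h0, hδ, h⟩ := h2.flip.exists_delta (hc hx) (hc hy) (hc hz) hxz
    refine ⟨δ, h0, hδ, fun ε hε hεδ => ?_⟩
    have := h ε hε hεδ
    unfold mixAct at this
    rwa [sub_sub_cancel] at this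

/-- `R` satisfies the first five axioms except possibly the convexity of lower contour sets, and
`u` is an affine utility for constant acts, normalized by `u x₀ = 1` and `u y₀ = -1`. -/
structure IsInvariantPref (X : Set V) (R : (S → V) → (S → V) → Prop) (u : V → ℝ) (x₀ y₀ : V) :
    Prop where
  convex : Convex ℝ X
  affine : IsAffineOn u X
  best_mem : x₀ ∈ X
  worst_mem : y₀ ∈ X
  best_eq : u x₀ = 1
  worst_eq : u y₀ = -1
  asymm : ∀ f g, IsAct X f → IsAct X g → R f g → ¬ R g f
  trans : ∀ f g h, IsAct X f → IsAct X g → IsAct X h → R f g → R g h → R f h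
  const_iff : ∀ x ∈ X, ∀ y ∈ X, (R (constAct S x) (constAct S y) ↔ u y < u x)
  continuity : PrefAx2 X R
  independence : PrefAx3 X R
  convex_upper : ∀ x ∈ X, ∀ f g, IsAct X f → IsAct X g → R f (constAct S x) →
    R g (constAct S x) → ∀ α : ℝ, 0 ≤ α → α ≤ 1 → R (mixAct α f g) (constAct S x)
  monotone : PrefAx5 X R

namespace IsInvariantPref

variable {u : V → ℝ} {x₀ y₀ : V}

theorem flip (h : IsInvariantPref X R u x₀ y₀) (h4 : PrefAx4 X R) :
    IsInvariantPref X (fun f g => R g f) (fun v => -u v) y₀ x₀ where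
  convex := h.convex
  affine := h.affine.neg
  best_mem := h.worst_mem
  worst_mem := h.best_mem
  best_eq := by rw [h.worst_eq, neg_neg]
  worst_eq := by rw [h.best_eq]
  asymm f g hf hg := h.asymm g f hg hf
  trans f g k hf hg hk h1 h2 := h.trans k g f hk hg hf h2 h1
  const_iff x hx y hy := by rw [h.const_iff y hy x hx, neg_lt_neg_iff]
  continuity := h.continuity.flip
  independence f g hf hg := h.independence g f hg hf
  convex_upper x hx := (h4 x hx).2
  monotone f g hf hg := h.monotone g f hg hf

variable {f : S → V} {x : V}

theorem const_lt (h : IsInvariantPref X R u x₀ y₀) (hf : IsAct X f) (hx : x ∈ X)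
    (hfx : ∀ s, u x < u (f s)) : R f (constAct S x) :=
  h.monotone _ _ hf (isAct_constAct hx) fun s => (h.const_iff _ (hf.1 s) x hx).2 (hfx s)

theorem not_const_lt (h : IsInvariantPref X R u x₀ y₀) (hf : IsAct X f) (hx : x ∈ X)
    (hfx : ∀ s, u (f s) ≤ u x) : ¬ R f (constAct S x) := by
  intro hR
  have hc := isAct_constAct (S := S) hx
  have hf' := hf.mix h.convex (isAct_constAct (S := S) h.worst_mem) (α := 1 / 2) (by norm_num)
    (by norm_num)
  have hw := convex_mix h.convex hx h.worst_mem (α := 1 / 2) (by norm_num) (by norm_num)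
  have hz := convex_mix h.convex hx h.best_mem (α := 1 / 2) (by norm_num) (by norm_num)
  rw [h.independence _ _ hf hc y₀ h.worst_mem (1 / 2) (by norm_num) (by norm_num)] at hR
  obtain ⟨δ, h0, h1, hδ⟩ := h.continuity.flip.exists_delta (isAct_constAct hw)
    (isAct_constAct hz) hf' hR
  have hmem := convex_mix h.convex hw hz (α := 1 - δ) (by linarith) (by linarith)
  refine h.asymm _ _ hf' (isAct_constAct hmem) (hδ δ h0 le_rfl)
    (h.monotone _ _ (isAct_constAct hmem) hf' fun s => (h.const_iff _ hmem _ (hf'.1 s)).2 ?_)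
  rw [utility_mix h.affine hf (isAct_constAct h.worst_mem) (by norm_num) (by norm_num),
    h.affine _ hw _ hz _ (by linarith) (by linarith),
    h.affine _ hx _ h.worst_mem _ (by norm_num) (by norm_num),
    h.affine _ hx _ h.best_mem _ (by norm_num) (by norm_num), h.best_eq,
    show u (constAct S y₀ s) = -1 from h.worst_eq, h.worst_eq]
  linarith [hfx s]

theorem exists_threshold [Nonempty S] (h : IsInvariantPref X R u x₀ y₀) (hf : IsAct X f) :
    ∃ y ∈ X, ∀ x ∈ X, (R f (constAct S x) ↔ u x < u y) := by
  have hc : ∀ {x}, x ∈ X → IsAct X (constAct S x) := fun hx => isAct_constAct hx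
  have down : ∀ x ∈ X, ∀ y ∈ X, R f (constAct S x) → u y < u x → R f (constAct S y) :=
    fun x hx y hy hR hlt => h.trans _ _ _ hf (hc hx) (hc hy) hR ((h.const_iff x hx y hy).2 hlt)
  have up : ∀ x ∈ X, R f (constAct S x) → ∃ y ∈ X, u x < u y ∧ R f (constAct S y) := by
    intro x hx hR
    obtain ⟨s, hs⟩ : ∃ s, u x < u (f s) := by
      by_contra! hcon
      exact h.not_const_lt hf hx hcon hR
    obtain ⟨δ, h0, h1, hδ⟩ := h.continuity.flip.exists_delta (hc hx) (hc (hf.1 s)) hf hR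
    refine ⟨_, convex_mix h.convex hx (hf.1 s) (α := 1 - δ) (by linarith) (by linarith), ?_,
      hδ δ h0 le_rfl⟩
    rw [h.affine _ hx _ (hf.1 s) _ (by linarith) (by linarith)]
    nlinarith
  obtain ⟨s, hs⟩ := exists_min_simpleFunc (hf.utility u)
  obtain ⟨t, ht⟩ := exists_max_simpleFunc (hf.utility u)
  set A := u '' {x | x ∈ X ∧ ¬ R f (constAct S x)} with hA
  have hbdd : u (f s) ∈ lowerBounds A := by
    rintro _ ⟨x, ⟨hx, hR⟩, rfl⟩
    by_contra! hlt
    exact hR (h.const_lt hf hx fun s' => hlt.trans_le (hs s'))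
  have hmem : u (f t) ∈ A := ⟨f t, ⟨hf.1 t, h.not_const_lt hf (hf.1 t) ht⟩, rfl⟩
  obtain ⟨y, hy, hyA⟩ := h.affine.exists_eq h.convex (hf.1 s) (hf.1 t)
    (le_csInf ⟨_, hmem⟩ hbdd) (csInf_le ⟨_, hbdd⟩ hmem)
  refine ⟨y, hy, fun x hx => ⟨fun hR => ?_, fun hlt => ?_⟩⟩
  · obtain ⟨x', hx', hlt, hR'⟩ := up x hx hR
    by_contra! hle
    rw [hyA] at hle
    obtain ⟨_, ⟨z, ⟨hz, hzR⟩, rfl⟩, hzx⟩ := exists_lt_of_csInf_lt ⟨_, hmem⟩ (hle.trans_lt hlt)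
    exact hzR (down x' hx' z hz hR' hzx)
  · by_contra hR
    exact (csInf_le ⟨_, hbdd⟩ ⟨x, ⟨hx, hR⟩, rfl⟩).not_gt (hyA ▸ hlt)

theorem exists_charges [Nonempty S] (h : IsInvariantPref X R u x₀ y₀) :
    ∃ C : Set (MSet S → ℝ), C.Nonempty ∧ C ⊆ ProbCharges S ∧ IsCompact C ∧ Convex ℝ C ∧
      ∀ f, IsAct X f → ∀ x ∈ X, (R f (constAct S x) ↔ u x < minEU u C f) := by
  have hc : ∀ {x}, x ∈ X → IsAct X (constAct S x) := fun hx => isAct_constAct hx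
  choose! y hyX hy using fun f (hf : IsAct X f) => h.exists_threshold hf
  have const_le : ∀ f, IsAct X f → ∀ x ∈ X, (∀ s, u x ≤ u (f s)) → u x ≤ u (y f) := by
    intro f hf x hx hxf
    by_contra! hlt
    exact lt_irrefl _ ((hy f hf _ (hyX f hf)).1
      (h.const_lt hf (hyX f hf) fun s => hlt.trans_le (hxf s)))
  have caff : ∀ f, IsAct X f → ∀ x ∈ X, ∀ α : ℝ, 0 < α → α < 1 →
      u (y (mixAct α f (constAct S x))) = α * u (y f) + (1 - α) * u x := by
    intro f hf x hx α h0 h1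
    have hm := hf.mix h.convex (hc hx) h0.le h1.le
    have hmix : ∀ z ∈ X, (u z < u (y f) ↔
        α * u z + (1 - α) * u x < u (y (mixAct α f (constAct S x)))) := fun z hz => by
      rw [← hy f hf z hz, h.independence _ _ hf (hc hz) x hx α h0 h1,
        ← h.affine _ hz _ hx α h0.le h1.le]
      exact hy _ hm _ (convex_mix h.convex hz hx h0.le h1.le)
    apply le_antisymm
    · exact not_lt.1 ((hmix _ (hyX f hf)).not.1 (lt_irrefl _))
    · by_contra! hlt
      by_cases hz : ∃ z ∈ X, u z < u (y f)
      · obtain ⟨z, hz, hzy⟩ := hz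
        obtain ⟨t, ht1, ht2⟩ := exists_between (max_lt hlt
          (show α * u z + (1 - α) * u x < α * u (y f) + (1 - α) * u x by nlinarith))
        rw [max_lt_iff] at ht1
        obtain ⟨w, hw, hwt⟩ := h.affine.exists_eq h.convex hz (hyX f hf)
          (r := (t - (1 - α) * u x) / α) (by rw [le_div_iff₀ h0]; linarith)
          (by rw [div_le_iff₀ h0]; linarith)
        rw [eq_div_iff h0.ne'] at hwt
        have := (hmix w hw).1 (by nlinarith)
        linarith
      · push Not at hz
        rw [← h.affine _ (hyX f hf) _ hx α h0.le h1.le] at hlt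
        refine hlt.not_ge (const_le _ hm _ (convex_mix h.convex (hyX f hf) hx h0.le h1.le) ?_)
        intro s
        rw [utility_mix h.affine hf (hc hx) h0.le h1.le,
          h.affine _ (hyX f hf) _ hx α h0.le h1.le]
        have := mul_le_mul_of_nonneg_left (hz _ (hf.1 s)) h0.le
        exact add_le_add_left this _
  have mono : ∀ f g, IsAct X f → IsAct X g → (∀ s, u (f s) ≤ u (g s)) → u (y f) ≤ u (y g) := by
    intro f g hf hg hfg
    by_contra! hlt
    set d := u (y f) - u (y g) with hd
    have hdpos : 0 < d := sub_pos.2 hlt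
    obtain ⟨α, h0, h1, hα⟩ : ∃ α : ℝ, 0 < α ∧ α < 1 ∧ 2 * (1 - α) < α * d :=
      ⟨4 / (4 + d), by positivity, by rw [div_lt_one (by positivity)]; linarith, by
        field_simp
        linarith⟩
    have hf' := hf.mix h.convex (hc h.worst_mem) h0.le h1.le
    have hg' := hg.mix h.convex (hc h.best_mem) h0.le h1.le
    have hR : R (mixAct α g (constAct S x₀)) (mixAct α f (constAct S y₀)) := by
      refine h.monotone _ _ hg' hf' fun s => (h.const_iff _ (hg'.1 s) _ (hf'.1 s)).2 ?_
      rw [utility_mix h.affine hf (hc h.worst_mem) h0.le h1.le,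
        utility_mix h.affine hg (hc h.best_mem) h0.le h1.le,
        show u (constAct S y₀ s) = -1 from h.worst_eq, show u (constAct S x₀ s) = 1 from h.best_eq]
      nlinarith [hfg s]
    have hle : u (y (mixAct α f (constAct S y₀))) ≤ u (y (mixAct α g (constAct S x₀))) := by
      by_contra! hcon
      have hyg := hyX _ hg'
      exact lt_irrefl _ ((hy _ hg' _ hyg).1
        (h.trans _ _ _ hg' hf' (hc hyg) hR ((hy _ hf' _ hyg).2 hcon)))
    rw [caff f hf _ h.worst_mem α h0 h1, caff g hg _ h.best_mem α h0 h1, h.best_eq,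
      h.worst_eq] at hle
    nlinarith
  obtain ⟨C, hCn, hCp, hC, hCv, hmin⟩ := exists_minEU_eq h.convex h.affine h.best_mem h.worst_mem
    h.best_eq h.worst_eq (a := fun f => u (y f)) mono caff fun f g hf hg => by
      by_contra! hlt
      have hm := hf.mix h.convex hg (α := 1 / 2) (by norm_num) (by norm_num)
      have hym := hyX _ hm
      rw [lt_min_iff] at hlt
      exact lt_irrefl _ ((hy _ hm _ hym).1 (h.convex_upper _ hym f g hf hg
        ((hy f hf _ hym).2 hlt.1) ((hy g hg _ hym).2 hlt.2) _ (by norm_num) (by norm_num)))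
  exact ⟨C, hCn, hCp, hC, hCv, fun f hf x hx => by rw [hy f hf x hx, hmin f hf]⟩

end IsInvariantPref

theorem exists_isHPRep_of_prefAx [Nonempty S] (hX : Convex ℝ X) (h1 : PrefAx1 X R)
    (h2 : PrefAx2 X R) (h3 : PrefAx3 X R) (h4 : PrefAx4 X R) (h5 : PrefAx5 X R)
    (h6 : PrefAx6 X R) (h7 : PrefAx7 X R) :
    ∃ (u : V → ℝ) (C D : Set (MSet S → ℝ)), IsHPRep X R u C D := by
  obtain ⟨v, hv, hvR⟩ := exists_utility_of_prefAx hX h1 h2 h3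
  obtain ⟨asymm, trans, ⟨x₀, hx₀, y₀, hy₀, h₀⟩, -⟩ := h1
  have hc : ∀ {x}, x ∈ X → IsAct X (constAct S x) := fun hx => isAct_constAct hx
  obtain ⟨k, hk, b, hb₁, hb₂, hu⟩ := exists_normalized hv ((hvR _ hx₀ _ hy₀).1 h₀)
  set u : V → ℝ := fun v' => k * v v' + b with hudef
  have hinv : IsInvariantPref X R u x₀ y₀ :=
    { convex := hX
      affine := hu
      best_mem := hx₀
      worst_mem := hy₀
      best_eq := hb₁
      worst_eq := hb₂
      asymm := asymm
      trans := trans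
      const_iff := fun x hx y hy => by
        rw [hvR x hx y hy, hudef, add_lt_add_iff_right, mul_lt_mul_iff_right₀ hk]
      continuity := h2
      independence := h3
      convex_upper := fun x hx => (h4 x hx).1
      monotone := h5 }
  have hn : NonConstOn u X := ⟨x₀, hx₀, y₀, hy₀, by rw [hinv.best_eq, hinv.worst_eq]; norm_num⟩
  obtain ⟨C, hCn, hCp, hC, hCv, hlow⟩ := hinv.exists_charges
  obtain ⟨D, hDn, hDp, hD, hDv, hup⟩ := (hinv.flip h4).exists_charges
  replace hup : ∀ f, IsAct X f → ∀ x ∈ X, (R (constAct S x) f ↔ maxEU u D f < u x) :=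
    fun f hf x hx => by
      rw [hup f hf x hx, minEU_neg_eq_neg_maxEU hDp hf, neg_lt_neg_iff]
  have hle : ∀ f, IsAct X f → minEU u C f ≤ maxEU u D f := by
    intro f hf
    by_contra! hlt
    obtain ⟨x, hx, hxC⟩ := minEU_mem_image hX hu hCp hC hCn hf
    obtain ⟨y, hy, hyD⟩ := maxEU_mem_image hX hu hDp hD hDn hf
    obtain ⟨t, ht1, ht2⟩ := exists_between hlt
    obtain ⟨z, hz, hzt⟩ := hu.exists_eq hX hy hx (r := t) (by linarith) (by linarith)
    exact asymm _ _ hf (hc hz) ((hlow f hf z hz).2 (by linarith)) ((hup f hf z hz).2 (by linarith))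
  have hinc : ∀ f, IsAct X f → ∀ x ∈ X,
      (Incomp R f (constAct S x) ↔ minEU u C f ≤ u x ∧ u x ≤ maxEU u D f) := fun f hf x hx => by
    rw [Incomp, hlow f hf x hx, hup f hf x hx, not_lt, not_lt]
  refine ⟨u, C, D, hu, hn, hCn, hDn, hCp, hDp, hC, hD, hCv, hDv, ?_, fun f g hf hg =>
    ⟨fun hR => ?_, fun ⟨hlt1, hlt2⟩ => ?_⟩⟩
  · by_contra hCD
    rw [Set.not_nonempty_iff_eq_empty, ← Set.disjoint_iff_inter_eq_empty] at hCD
    obtain ⟨f, hf, r, hr1, hr2⟩ := exists_act_separating hX hu hn hDp hCp hD hC hDv hCv hCD.symm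
    obtain ⟨p, hp, hpf⟩ := exists_EU_eq_minEU (u := u) hC hCn hf
    obtain ⟨q, hq, hqf⟩ := exists_EU_eq_minEU (u := fun v' => -u v') hD hDn hf
    rw [EU_neg hf (hDp hq), minEU_neg_eq_neg_maxEU hDp hf] at hqf
    linarith [hle f hf, hr1 q hq, hr2 p hp]
  · have hCle : minEU u C g ≤ minEU u C f := by
      by_contra! hlt
      obtain ⟨z, hz, hzf⟩ := minEU_mem_image hX hu hCp hC hCn hf
      have := trans _ _ _ hf hg (hc hz) hR ((hlow g hg z hz).2 (by linarith))
      linarith [(hlow f hf z hz).1 this]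
    have hDle : maxEU u D g ≤ maxEU u D f := by
      by_contra! hlt
      obtain ⟨z, hz, hzg⟩ := maxEU_mem_image hX hu hDp hD hDn hg
      have := trans _ _ _ (hc hz) hf hg ((hup f hf z hz).2 (by linarith)) hR
      linarith [(hup g hg z hz).1 this]
    refine ⟨hCle.lt_of_ne fun heq => ?_, hDle.lt_of_ne fun heq => ?_⟩
    · refine (h6 g f hg hf fun z hz => ?_).2 hR
      rw [hinc f hf z hz, hinc g hg z hz]
      exact fun hz => ⟨by linarith [hz.1], by linarith [hz.2]⟩
    · refine (h6 f g hf hg fun z hz => ?_).1 hR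
      rw [hinc f hf z hz, hinc g hg z hz]
      exact fun hz => ⟨by linarith [hz.1], by linarith [hz.2]⟩
  · obtain ⟨x, hx, hxD⟩ := maxEU_mem_image hX hu hDp hD hDn hf
    obtain ⟨y, hy, hyC⟩ := minEU_mem_image hX hu hCp hC hCn hg
    refine h7 f g hf hg x hx y hy ((hinc f hf x hx).2 ⟨(hle f hf).trans hxD.ge, hxD.le⟩)
      ((hup g hg x hx).2 (by linarith)) ((hinc g hg y hy).2 ⟨hyC.ge, hyC.le.trans (hle g hg)⟩)
      ((hlow f hf y hy).2 (by linarith))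

end Construction

section Statement

variable {S : Type*} [MeasurableSpace S] [Nonempty S]
variable {V : Type*} [AddCommGroup V] [Module ℝ V]

/-- Theorem 1: a binary relation `≻` on `F` satisfies
Axioms 1–7 iff it admits a hope-and-prepare representation `(u, C, D)`;
moreover `u` is unique up to positive affine transformation and `(C, D)`
is unique. -/
theorem statement0 (X : Set V) (hX : Convex ℝ X) (hX2 : ∃ x ∈ X, ∃ y ∈ X, x ≠ y)
    (R : (S → V) → (S → V) → Prop) :
    ((PrefAx1 X R ∧ PrefAx2 X R ∧ PrefAx3 X R ∧ PrefAx4 X R ∧ PrefAx5 X R ∧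
        PrefAx6 X R ∧ PrefAx7 X R) ↔
      ∃ (u : V → ℝ) (C D : Set (MSet S → ℝ)), IsHPRep X R u C D) ∧
    (∀ (u u' : V → ℝ) (C D C' D' : Set (MSet S → ℝ)),
      IsHPRep X R u C D → IsHPRep X R u' C' D' →
      ((∃ a : ℝ, 0 < a ∧ ∃ b : ℝ, ∀ x ∈ X, u' x = a * u x + b) ∧ C' = C ∧ D' = D)) := by
  refine ⟨⟨fun ⟨h1, h2, h3, h4, h5, h6, h7⟩ => exists_isHPRep_of_prefAx hX h1 h2 h3 h4 h5 h6 h7,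
    fun ⟨_, _, _, h⟩ => h.prefAx hX⟩, fun u u' C D C' D' h h' => ?_⟩
  exact ⟨h.exists_affine hX h', h.lower_unique hX h', h.flip.lower_unique hX h'.flip⟩

end Statement
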